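/- Let α and β be fixed real numbers with α irrational. Then for every ε > 0, for all sufficiently large primes p, there exists a positive integer n with n ≤ p^{1/(4√e) + ε} such that ⌊αn + β⌋ is a quadratic non-residue modulo p (i.e., the least such index N_{α,β}(p) satisfies N_{α,β}(p) ≤ p^{1/(4√e) + ε}). -/

import Mathlib

namespace BeattyNonresidue

open Polynomial

/-- The operator `h ↦ c f' h + f h'`, so that `(f ^ c * h)' = f ^ (c - 1) * twist f c h`. -/
noncomputable def twist {F : Type*} [Field F] (f : F[X]) (c : F) : F[X] →ₗ[F] F[X] :=
  LinearMap.mulLeft F (C c * derivative f) + LinearMap.mulLeft F f ∘ₗ derivative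

/-- The operator with `(f ^ m * h)^(k) = f ^ (m - k) * iterTwist f m k h`. -/
noncomputable def iterTwist {F : Type*} [Field F] (f : F[X]) (m : ℕ) : ℕ → F[X] →ₗ[F] F[X]
  | 0 => LinearMap.id
  | k + 1 => twist f ((m - k : ℕ) : F) ∘ₗ iterTwist f m k

section Field

variable {F : Type*} [Field F]

lemma twist_apply (f : F[X]) (c : F) (h : F[X]) :
    twist f c h = C c * derivative f * h + f * derivative h := rfl

lemma iterTwist_succ_apply (f : F[X]) (m k : ℕ) (h : F[X]) :
    iterTwist f m (k + 1) h = twist f ((m - k : ℕ) : F) (iterTwist f m k h) := rfl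

lemma iterate_derivative_pow_mul (f : F[X]) (m k : ℕ) (hk : k ≤ m) (h : F[X]) :
    derivative^[k] (f ^ m * h) = f ^ (m - k) * iterTwist f m k h := by
  induction k with
  | zero => simp [iterTwist]
  | succ k ih =>
    rw [Function.iterate_succ_apply', ih (by omega), iterTwist_succ_apply, twist_apply]
    obtain ⟨j, hj⟩ : ∃ j, m - k = j + 1 := ⟨m - k - 1, by omega⟩
    have hj' : m - (k + 1) = j := by omega
    rw [hj, hj', derivative_mul, derivative_pow]
    simp only [Nat.add_sub_cancel, map_natCast]
    ring

lemma iterTwist_mul_of_derivative_eq_zero (f : F[X]) (m k : ℕ) (h u : F[X])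
    (hu : derivative u = 0) : iterTwist f m k (h * u) = iterTwist f m k h * u := by
  induction k with
  | zero => rfl
  | succ k ih =>
    rw [iterTwist_succ_apply, ih, iterTwist_succ_apply, twist_apply, twist_apply,
      derivative_mul, hu]
    ring

lemma natDegree_iterTwist_le (f : F[X]) (m k : ℕ) (h : F[X]) :
    (iterTwist f m k h).natDegree ≤ h.natDegree + k * f.natDegree := by
  induction k with
  | zero => simp [iterTwist]
  | succ k ih =>
    rw [iterTwist_succ_apply, twist_apply]
    refine (natDegree_add_le _ _).trans (max_le ?_ ?_)
    · refine natDegree_mul_le.trans ?_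
      have h1 : (C ((m - k : ℕ) : F) * derivative f).natDegree ≤ f.natDegree :=
        (natDegree_C_mul_le _ _).trans ((natDegree_derivative_le f).trans (Nat.sub_le _ _))
      rw [Nat.succ_mul]
      omega
    · refine natDegree_mul_le.trans ?_
      have h1 := natDegree_derivative_le (iterTwist f m k h)
      rw [Nat.succ_mul]
      omega

/-- Linear algebra: auxiliary polynomials annihilating all the relevant derivatives. -/
lemma exists_auxiliary_polynomials (f : F[X]) (m₁ m₂ J n l : ℕ) (hn : 0 < n)
    (hdim : l * (n + l * f.natDegree + J) < 2 * (J * n)) :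
    ∃ r s : ℕ → F[X], (∀ j, (r j).natDegree < n) ∧ (∀ j, (s j).natDegree < n) ∧
      (∃ j < J, r j ≠ 0 ∨ s j ≠ 0) ∧
      ∀ k < l, ∑ j ∈ Finset.range J, (iterTwist f m₁ k (r j) + iterTwist f m₂ k (s j)) * X ^ j
        = 0 := by
  classical
  set D := n + l * f.natDegree + J with hD
  let P : (Fin n → F) →ₗ[F] F[X] :=
    (degreeLT F n).subtype ∘ₗ (degreeLTEquiv F n).symm.toLinearMap
  have hPdeg : ∀ v, (P v).natDegree < n := fun v => by
    have h1 : P v ∈ degreeLT F n := ((degreeLTEquiv F n).symm v).2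
    rw [mem_degreeLT] at h1
    by_cases h0 : P v = 0
    · rw [h0]; simpa using hn
    · exact (natDegree_lt_iff_degree_lt h0).2 h1
  have hPinj : Function.Injective P :=
    Subtype.val_injective.comp (degreeLTEquiv F n).symm.injective
  let ext : (Fin J → Fin n → F) → ℕ → F[X] := fun v j => if h : j < J then P (v ⟨j, h⟩) else 0
  let S : ℕ → ((Fin J → Fin n → F) × (Fin J → Fin n → F)) →ₗ[F] F[X] := fun k =>
    ∑ j : Fin J, LinearMap.mulRight F (X ^ (j : ℕ)) ∘ₗ
      (iterTwist f m₁ k ∘ₗ P ∘ₗ LinearMap.proj j ∘ₗ LinearMap.fst F _ _ +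
        iterTwist f m₂ k ∘ₗ P ∘ₗ LinearMap.proj j ∘ₗ LinearMap.snd F _ _)
  let Φ : ((Fin J → Fin n → F) × (Fin J → Fin n → F)) →ₗ[F] (Fin l → Fin D → F) :=
    LinearMap.pi fun k => LinearMap.pi fun i => lcoeff F i ∘ₗ S k
  have hker : LinearMap.ker Φ ≠ ⊥ := by
    apply LinearMap.ker_ne_bot_of_finrank_lt
    simp only [Module.finrank_prod, Module.finrank_pi_fintype, Module.finrank_self,
      Finset.sum_const, Finset.card_univ, Fintype.card_fin, smul_eq_mul, mul_one]
    omega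
  obtain ⟨v, hv, hv0⟩ := Submodule.exists_mem_ne_zero_of_ne_bot hker
  have hext : ∀ w j, (ext w j).natDegree < n := fun w j => by
    by_cases h : j < J
    · simp only [ext, h, dif_pos]; exact hPdeg _
    · simp only [ext, h, dif_neg, not_false_eq_true, natDegree_zero]; exact hn
  refine ⟨ext v.1, ext v.2, hext _, hext _, ?_, ?_⟩
  · by_contra! hcon
    apply hv0
    have key : ∀ w : Fin J → Fin n → F, (∀ j < J, ext w j = 0) → w = 0 := fun w hw => by
      funext j
      have := hw j j.2
      simp only [ext, j.2, dif_pos] at this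
      exact hPinj (by simpa using this)
    exact Prod.ext (key _ fun j hj => (hcon j hj).1) (key _ fun j hj => (hcon j hj).2)
  · intro k hk
    have hS : S k v = ∑ j ∈ Finset.range J,
        (iterTwist f m₁ k (ext v.1 j) + iterTwist f m₂ k (ext v.2 j)) * X ^ j := by
      rw [Finset.sum_range]
      simp only [S, ext, LinearMap.sum_apply]
      refine Finset.sum_congr rfl fun j _ => ?_
      simp
    rw [← hS]
    ext i
    by_cases hi : i < D
    · have := congrFun (congrFun (LinearMap.mem_ker.1 hv) ⟨k, hk⟩) ⟨i, hi⟩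
      simpa [Φ] using this
    · rw [coeff_zero]
      apply coeff_eq_zero_of_natDegree_lt
      refine lt_of_lt_of_le ?_ (not_lt.1 hi)
      rw [hS]
      refine lt_of_le_of_lt (natDegree_sum_le_of_forall_le (n := D - 1) _ _ fun j hj => ?_)
        (by omega)
      refine natDegree_mul_le.trans ?_
      have hj' := Finset.mem_range.1 hj
      have hX : (X ^ j : F[X]).natDegree = j := natDegree_X_pow j
      have hkl : k * f.natDegree ≤ l * f.natDegree := Nat.mul_le_mul_right _ hk.le
      have h1 := natDegree_iterTwist_le f m₁ k (ext v.1 j)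
      have h2 := natDegree_iterTwist_le f m₂ k (ext v.2 j)
      have h3 := hext v.1 j
      have h4 := hext v.2 j
      have h5 := natDegree_add_le (iterTwist f m₁ k (ext v.1 j)) (iterTwist f m₂ k (ext v.2 j))
      have h6 := max_le (h1.trans (Nat.add_le_add_right h3.le _) |>.trans
        (Nat.add_le_add_left hkl _)) (h2.trans (Nat.add_le_add_right h4.le _) |>.trans
        (Nat.add_le_add_left hkl _))
      omega

end Field

section ZMod

variable {p : ℕ} [hp : Fact p.Prime]

lemma eq_zero_of_mul_sq_eq (f r s : (ZMod p)[X]) (hf0 : f.eval 0 ≠ 0) (a : ZMod p)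
    (ha : Odd (f.rootMultiplicity a)) (h : f * r ^ 2 = C (f.eval 0) * s ^ 2) :
    r = 0 ∧ s = 0 := by
  have hf : f ≠ 0 := by rintro rfl; simp at hf0
  have hC : (C (f.eval 0) : (ZMod p)[X]) ≠ 0 := by simpa using hf0
  by_cases hr : r = 0
  · refine ⟨hr, ?_⟩
    rw [hr] at h
    simpa [hC, eq_comm] using h
  · exfalso
    have hs : s ≠ 0 := by
      rintro rfl
      simp [hf, hr] at h
    have h1 := congrArg (rootMultiplicity a) h
    rw [rootMultiplicity_mul (mul_ne_zero hf (pow_ne_zero _ hr)),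
      rootMultiplicity_mul (mul_ne_zero hC (pow_ne_zero _ hs)), rootMultiplicity_C,
      pow_two, pow_two, rootMultiplicity_mul (mul_ne_zero hr hr),
      rootMultiplicity_mul (mul_ne_zero hs hs)] at h1
    obtain ⟨k, hk⟩ := ha
    omega

lemma auxiliary_polynomial_injective (hp2 : p ≠ 2) (f : (ZMod p)[X]) (hf0 : f.eval 0 ≠ 0)
    (a : ZMod p) (ha : Odd (f.rootMultiplicity a)) (n : ℕ) (hn : 2 * n + f.natDegree ≤ p + 1)
    (J : ℕ) (r s : ℕ → (ZMod p)[X]) (hr : ∀ j, (r j).natDegree < n)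
    (hs : ∀ j, (s j).natDegree < n)
    (h : ∑ j ∈ Finset.range J, r j * X ^ (p * j) +
      f ^ ((p - 1) / 2) * ∑ j ∈ Finset.range J, s j * X ^ (p * j) = 0) :
    ∀ j < J, r j = 0 ∧ s j = 0 := by
  induction J generalizing r s with
  | zero => intro j hj; omega
  | succ J ih =>
    have hsum : ∀ t : ℕ → (ZMod p)[X], ∑ j ∈ Finset.range (J + 1), t j * X ^ (p * j) =
        t 0 + X ^ p * ∑ j ∈ Finset.range J, t (j + 1) * X ^ (p * j) := fun t => by
      rw [Finset.sum_range_succ', add_comm, Finset.mul_sum]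
      congr 1
      · simp
      · refine Finset.sum_congr rfl fun j _ => ?_
        rw [mul_add, pow_add]; ring
    rw [hsum, hsum] at h
    set A := ∑ j ∈ Finset.range J, r (j + 1) * X ^ (p * j) with hA
    set B := ∑ j ∈ Finset.range J, s (j + 1) * X ^ (p * j) with hB
    have hodd : p = 2 * ((p - 1) / 2) + 1 := by
      have := hp.out.eq_two_or_odd
      omega
    have hfp : f ^ p = expand (ZMod p) p f := (ZMod.expand_card f).symm
    obtain ⟨E, hE⟩ : ∃ E, f = C (f.eval 0) + X * E := by
      have : X ∣ f - C (f.eval 0) := by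
        rw [X_dvd_iff, coeff_sub, coeff_C_zero, coeff_zero_eq_eval_zero, sub_self]
      obtain ⟨E, hE⟩ := this
      exact ⟨E, by rw [← hE]; ring⟩
    have hexp : expand (ZMod p) p f = C (f.eval 0) + X ^ p * expand (ZMod p) p E := by
      conv_lhs => rw [hE]
      simp
    have hsq : f * (r 0 + X ^ p * A) ^ 2 = f ^ p * (s 0 + X ^ p * B) ^ 2 := by
      have h1 : r 0 + X ^ p * A = -(f ^ ((p - 1) / 2) * (s 0 + X ^ p * B)) :=
        eq_neg_of_add_eq_zero_left h
      have h2 : f ^ p = f ^ (2 * ((p - 1) / 2) + 1) := congrArg (f ^ ·) hodd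
      rw [h1, h2]
      ring
    have hdvd : X ^ p ∣ f * r 0 ^ 2 - C (f.eval 0) * s 0 ^ 2 := by
      refine ⟨expand (ZMod p) p E * (s 0 + X ^ p * B) ^ 2 +
        C (f.eval 0) * (2 * s 0 * B + X ^ p * B ^ 2) - f * (2 * r 0 * A + X ^ p * A ^ 2), ?_⟩
      rw [hfp, hexp] at hsq
      linear_combination hsq
    have hdeg : (f * r 0 ^ 2 - C (f.eval 0) * s 0 ^ 2).natDegree < p := by
      have h1 := hr 0
      have h2 := hs 0
      refine lt_of_le_of_lt (natDegree_sub_le _ _) (max_lt ?_ ?_)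
      · refine lt_of_le_of_lt natDegree_mul_le ?_
        rw [natDegree_pow]; omega
      · refine lt_of_le_of_lt (natDegree_C_mul_le _ _) ?_
        rw [natDegree_pow]; omega
    have hzero : f * r 0 ^ 2 - C (f.eval 0) * s 0 ^ 2 = 0 := by
      by_contra hne
      have := natDegree_le_of_dvd hdvd hne
      rw [natDegree_X_pow] at this
      omega
    obtain ⟨hr0, hs0⟩ := eq_zero_of_mul_sq_eq f (r 0) (s 0) hf0 a ha (sub_eq_zero.1 hzero)
    have htail : A + f ^ ((p - 1) / 2) * B = 0 := by
      rw [hr0, hs0] at h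
      have h1 : (X ^ p : (ZMod p)[X]) * (A + f ^ ((p - 1) / 2) * B) = 0 := by
        linear_combination h
      exact (mul_eq_zero.1 h1).resolve_left (pow_ne_zero _ X_ne_zero)
    have hrec := ih (fun j => r (j + 1)) (fun j => s (j + 1)) (fun j => hr _) (fun j => hs _) htail
    intro j hj
    cases j with
    | zero => exact ⟨hr0, hs0⟩
    | succ j => exact hrec j (by omega)

lemma card_mul_le_natDegree {F : Type*} [Field F] [DecidableEq F] (R : F[X]) (Z : Finset F)
    (l : ℕ) (h : ∀ x ∈ Z, l ≤ R.rootMultiplicity x) : Z.card * l ≤ R.natDegree := by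
  calc Z.card * l = ∑ x ∈ Z, l := by simp
    _ ≤ ∑ x ∈ Z, R.roots.count x := Finset.sum_le_sum fun x hx => by
        rw [count_roots]; exact h x hx
    _ ≤ ∑ x ∈ Z ∪ R.roots.toFinset, R.roots.count x :=
        Finset.sum_le_sum_of_subset Finset.subset_union_left
    _ = Multiset.card R.roots := Multiset.sum_count_eq_card fun x hx =>
        Finset.mem_union_right _ (Multiset.mem_toFinset.2 hx)
    _ ≤ R.natDegree := card_roots' R

/-- Stepanov's method. -/
lemma stepanov_card_le (hp2 : p ≠ 2) (f : (ZMod p)[X]) (hf0 : f.eval 0 ≠ 0)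
    (a : ZMod p) (ha : Odd (f.rootMultiplicity a)) (n : ℕ) (hn0 : 0 < n)
    (hn : 2 * n + f.natDegree ≤ p + 1) (J l : ℕ) (hl : l < p)
    (hdim : l * (n + l * f.natDegree + J) < 2 * (J * n)) :
    (Finset.univ.filter fun x => quadraticChar (ZMod p) (f.eval x) = 1).card * l ≤
      l * f.natDegree + (p - 1) / 2 * f.natDegree + n + p * J := by
  classical
  set g := (p - 1) / 2 with hg
  obtain ⟨r, s, hr, hs, ⟨j₀, hj₀, hne⟩, hσ⟩ :=
    exists_auxiliary_polynomials f l (l + g) J n l hn0 hdim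
  set R : (ZMod p)[X] := f ^ l * ∑ j ∈ Finset.range J, r j * X ^ (p * j) +
    f ^ (l + g) * ∑ j ∈ Finset.range J, s j * X ^ (p * j) with hR
  have hf : f ≠ 0 := by rintro rfl; simp at hf0
  have hR0 : R ≠ 0 := fun h0 => by
    have h1 : f ^ l * (∑ j ∈ Finset.range J, r j * X ^ (p * j) +
        f ^ g * ∑ j ∈ Finset.range J, s j * X ^ (p * j)) = 0 := by
      rw [← h0, hR, pow_add]; ring
    have h2 := auxiliary_polynomial_injective hp2 f hf0 a ha n hn J r s hr hs
      ((mul_eq_zero.1 h1).resolve_left (pow_ne_zero _ hf)) j₀ hj₀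
    exact hne.elim (fun h => h h2.1) (fun h => h h2.2)
  have hX : ∀ j, derivative (X ^ (p * j) : (ZMod p)[X]) = 0 := fun j => by
    rw [derivative_X_pow]; simp
  have hderiv : ∀ m k, k ≤ m → ∀ t : ℕ → (ZMod p)[X], ∀ x : ZMod p,
      (derivative^[k] (f ^ m * ∑ j ∈ Finset.range J, t j * X ^ (p * j))).eval x =
        f.eval x ^ (m - k) * ∑ j ∈ Finset.range J, (iterTwist f m k (t j)).eval x * x ^ j := by
    intro m k hk t x
    rw [iterate_derivative_pow_mul f m k hk, map_sum, eval_mul, eval_pow, eval_finsetSum]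
    congr 1
    refine Finset.sum_congr rfl fun j _ => ?_
    rw [iterTwist_mul_of_derivative_eq_zero _ _ _ _ _ (hX j), eval_mul, eval_pow, eval_X,
      pow_mul, ZMod.pow_card]
  refine (card_mul_le_natDegree R _ l fun x hx => ?_).trans ?_
  · rw [Finset.mem_filter] at hx
    have hx1 : f.eval x ^ g = 1 := by
      have h1 := quadraticChar_eq_pow_of_char_ne_two' (F := ZMod p)
        (by rwa [ZMod.ringChar_zmod_n]) (f.eval x)
      rw [hx.2, ZMod.card] at h1
      have h2 : p / 2 = g := by
        have := hp.out.eq_two_or_odd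
        omega
      rw [h2] at h1
      rw [← h1]; simp
    rcases Nat.eq_zero_or_pos l with h0 | hlpos
    · omega
    have : l - 1 < R.rootMultiplicity x := by
      refine lt_rootMultiplicity_of_isRoot_iterate_derivative_of_mem_nonZeroDivisors hR0 ?_ ?_
      · intro k hk
        have hkl : k < l := by omega
        rw [IsRoot, hR, iterate_map_add, eval_add, hderiv l k hkl.le r,
          hderiv (l + g) k (by omega) s]
        have h1 : l + g - k = (l - k) + g := by omega
        rw [h1, pow_add, hx1, mul_one, ← mul_add, ← Finset.sum_add_distrib]
        have h2 := congrArg (eval x) (hσ k hkl)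
        rw [eval_finsetSum, eval_zero] at h2
        simp only [eval_mul, eval_add, eval_pow, eval_X, add_mul] at h2
        rw [h2, mul_zero]
      · rw [mem_nonZeroDivisors_iff_ne_zero, Ne, ZMod.natCast_eq_zero_iff,
          hp.out.dvd_factorial]
        omega
    omega
  · have hsum : ∀ t : ℕ → (ZMod p)[X], (∀ j, (t j).natDegree < n) →
        (∑ j ∈ Finset.range J, t j * X ^ (p * j)).natDegree ≤ n + p * J := fun t ht => by
      refine natDegree_sum_le_of_forall_le _ _ fun j hj => natDegree_mul_le.trans ?_
      rw [natDegree_X_pow]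
      exact add_le_add (ht j).le (Nat.mul_le_mul_left _ (Finset.mem_range.1 hj).le)
    have h1 := hsum r hr
    have h2 := hsum s hs
    refine (natDegree_add_le _ _).trans (max_le ?_ ?_)
    · refine natDegree_mul_le.trans ?_
      rw [natDegree_pow]
      have := Nat.zero_le (g * f.natDegree)
      omega
    · refine natDegree_mul_le.trans ?_
      rw [natDegree_pow, add_mul]
      omega

/-- A Weil-type upper bound for character sums of the quadratic character. -/
theorem sum_quadraticChar_eval_le (hp2 : p ≠ 2) (f : (ZMod p)[X]) (hf0 : f.eval 0 ≠ 0)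
    (a : ZMod p) (ha : Odd (f.rootMultiplicity a)) :
    ∑ x : ZMod p, (quadraticChar (ZMod p) (f.eval x) : ℝ) ≤
      27 * (f.natDegree + 1) * √p := by
  classical
  set d := f.natDegree with hd
  set l := Nat.sqrt p with hl
  have hl1 : l * l ≤ p := Nat.sqrt_le p
  have hl2 : p < (l + 1) * (l + 1) := Nat.lt_succ_sqrt p
  have hp2' := hp.out.two_le
  have hlpos : 1 ≤ l := by
    by_contra h
    have : l = 0 := by omega
    rw [this] at hl2; omega
  have hlsqrt : (l : ℝ) ≤ √p := Real.le_sqrt_of_sq_le (by rw [sq]; exact_mod_cast hl1)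
  have hp3 : p ≤ 3 * (l * l) := by nlinarith
  suffices hmain : ∑ x : ZMod p, quadraticChar (ZMod p) (f.eval x) ≤ 27 * (d + 1) * (l : ℤ) by
    have h1 : ∑ x : ZMod p, (quadraticChar (ZMod p) (f.eval x) : ℝ) ≤ 27 * (d + 1) * (l : ℝ) := by
      exact_mod_cast hmain
    exact h1.trans (by gcongr)
  rcases lt_or_ge l (2 * d + 4) with hsmall | hlarge
  · have h1 : ∑ x : ZMod p, quadraticChar (ZMod p) (f.eval x) ≤ ∑ x : ZMod p, 1 := by
      refine Finset.sum_le_sum fun x _ => ?_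
      rcases eq_or_ne (f.eval x) 0 with h | h
      · simp [h]
      · rcases quadraticChar_dichotomy h with h | h <;> rw [h] <;> norm_num
    refine h1.trans ?_
    simp only [Finset.sum_const, Finset.card_univ, ZMod.card, nsmul_eq_mul, mul_one]
    have : p ≤ 27 * (d + 1) * l := by nlinarith
    exact_mod_cast this
  · set n := (p - d) / 2 with hn
    set J := l / 2 + (2 * d + 4) with hJ
    have hpl : l * (2 * d + 4) ≤ p := (Nat.mul_le_mul_left _ hlarge).trans hl1
    have hpd : 4 * (2 * d + 4) ≤ p := (Nat.mul_le_mul_right _ (by omega)).trans hpl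
    have hn4 : p ≤ 4 * n := by omega
    have hJ1 : l + 4 * d + 7 ≤ 2 * J := by omega
    have hJ2 : 2 * J ≤ l + 4 * d + 8 := by omega
    have hlp : l < p := by nlinarith
    have hdim : l * (n + l * d + J) < 2 * (J * n) := by
      have h1 : (l + 4 * d + 7) * n ≤ 2 * J * n := Nat.mul_le_mul_right _ hJ1
      have h2 : l * (2 * J) ≤ l * (l + 4 * d + 8) := Nat.mul_le_mul_left _ hJ2
      have h3 : l * l * d ≤ p * d := Nat.mul_le_mul_right _ hl1
      have h4 : p * d ≤ 4 * n * d := Nat.mul_le_mul_right _ hn4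
      nlinarith
    have hZ := stepanov_card_le hp2 f hf0 a ha n (by omega) (by omega) J l hlp hdim
    set Z := (Finset.univ.filter fun x => quadraticChar (ZMod p) (f.eval x) = 1).card with hZdef
    have hsum : ∑ x : ZMod p, quadraticChar (ZMod p) (f.eval x) ≤ 2 * (Z : ℤ) + d - p := by
      have h0 : (Finset.univ.filter fun x => f.eval x = 0).card ≤ d := by
        have hf : f ≠ 0 := by rintro rfl; simp at hf0
        refine le_trans (Finset.card_le_card (t := f.roots.toFinset) fun x hx => ?_)
          ((Multiset.toFinset_card_le _).trans (card_roots' f))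
        rw [Multiset.mem_toFinset, mem_roots hf]
        exact (Finset.mem_filter.1 hx).2
      have h1 : ∑ x : ZMod p, quadraticChar (ZMod p) (f.eval x) =
          ∑ x : ZMod p, (2 * (if quadraticChar (ZMod p) (f.eval x) = 1 then (1 : ℤ) else 0) +
            (if f.eval x = 0 then 1 else 0) - 1) := by
        refine Finset.sum_congr rfl fun x _ => ?_
        rcases eq_or_ne (f.eval x) 0 with h | h
        · simp [h]
        · rcases quadraticChar_dichotomy h with h' | h' <;> simp [h, h']
      rw [h1, Finset.sum_sub_distrib, Finset.sum_add_distrib, ← Finset.mul_sum,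
        ← Finset.natCast_card_filter, ← Finset.natCast_card_filter]
      simp only [Finset.sum_const, Finset.card_univ, ZMod.card, nsmul_eq_mul, mul_one]
      have h0' : ((Finset.univ.filter fun x => f.eval x = 0).card : ℤ) ≤ d := by exact_mod_cast h0
      linarith
    refine hsum.trans ?_
    have h1 : 2 * (Z * l) ≤ 2 * (l * d) + p * d + p + p * (2 * J) := by
      have h2 : 2 * ((p - 1) / 2) ≤ p := by omega
      have h3 : 2 * ((p - 1) / 2) * d ≤ p * d := Nat.mul_le_mul_right _ h2
      have h4 : 2 * n ≤ p := by omega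
      rw [← hd] at hZ
      nlinarith
    have h2 : p * (2 * J) ≤ p * (l + 4 * d + 8) := Nat.mul_le_mul_left _ hJ2
    have h3 : p * (5 * d + 9) ≤ 3 * (l * l) * (5 * d + 9) := Nat.mul_le_mul_right _ hp3
    have h4 : 2 * (Z * l) ≤ (2 * d + p + 3 * l * (5 * d + 9)) * l := by nlinarith
    have h5 : 2 * Z ≤ 2 * d + p + 3 * l * (5 * d + 9) := by
      refine Nat.le_of_mul_le_mul_right ?_ hlpos
      linarith
    have h6 : 2 * Z + d ≤ p + 27 * (d + 1) * l := by nlinarith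
    have h7 : 2 * (Z : ℤ) + d ≤ p + 27 * (d + 1) * l := by exact_mod_cast h6
    linarith

end ZMod

end BeattyNonresidue

namespace BeattyNonresidue

open Polynomial

section Moments

variable {p : ℕ} [hp : Fact p.Prime]

variable (p) in
/-- The quadratic character modulo `p` with real values. -/
noncomputable def qchar (x : ZMod p) : ℝ := (quadraticChar (ZMod p) x : ℝ)

lemma qchar_mul (x y : ZMod p) : qchar p (x * y) = qchar p x * qchar p y := by
  simp only [qchar, map_mul, Int.cast_mul]

lemma qchar_zero : qchar p 0 = 0 := by simp [qchar]

lemma qchar_eq_one_or {x : ZMod p} (hx : x ≠ 0) : qchar p x = 1 ∨ qchar p x = -1 := by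
  rcases quadraticChar_dichotomy hx with h | h <;> simp [qchar, h]

lemma abs_qchar_of_ne_zero {x : ZMod p} (hx : x ≠ 0) : |qchar p x| = 1 := by
  rcases qchar_eq_one_or hx with h | h <;> simp [h]

lemma abs_qchar_le (x : ZMod p) : |qchar p x| ≤ 1 := by
  rcases eq_or_ne x 0 with rfl | h
  · simp [qchar_zero]
  · exact (abs_qchar_of_ne_zero h).le

lemma sum_prod_qchar_le (hp2 : p ≠ 2) {ι : Type*} [DecidableEq ι] (c : ι → ZMod p)
    (hc : Function.Injective c) (hc0 : ∀ i, c i ≠ 0) (m : ℕ) (t : Fin m → ι) (j : ι)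
    (hj : Odd (Finset.univ.filter fun i => t i = j).card) :
    ∑ u : ZMod p, ∏ i, qchar p (u + c (t i)) ≤ 27 * (m + 1) * √p := by
  classical
  set s : Multiset (ZMod p) := Finset.univ.val.map fun i => -c (t i) with hs
  set f : (ZMod p)[X] := (s.map fun a => X - C a).prod with hf
  have hfprod : f = ∏ i, (X + C (c (t i))) := by
    rw [hf, hs, Multiset.map_map]
    simp [Finset.prod]
  have heval : ∀ u, f.eval u = ∏ i, (u + c (t i)) := fun u => by
    rw [hfprod, eval_prod]; simp
  have hdeg : f.natDegree = m := by
    rw [hf, natDegree_multiset_prod_X_sub_C_eq_card, hs]; simp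
  have hroot : f.rootMultiplicity (-c j) = (Finset.univ.filter fun i => t i = j).card := by
    rw [← count_roots, hf, roots_multiset_prod_X_sub_C, hs, Multiset.count_map]
    rw [Finset.card_def, Finset.filter_val]
    congr 1
    refine Multiset.filter_congr fun i _ => ?_
    rw [neg_inj, hc.eq_iff, eq_comm]
  have h := sum_quadraticChar_eval_le hp2 f (by
    rw [heval]; exact Finset.prod_ne_zero_iff.2 fun i _ => by simpa using hc0 _) (-c j)
    (by rw [hroot]; exact hj)
  rw [hdeg] at h
  refine le_trans (le_of_eq (Finset.sum_congr rfl fun u _ => ?_)) h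
  rw [heval, map_prod]
  simp [qchar]

lemma card_even_fibers_le {ι : Type*} [Fintype ι] [DecidableEq ι] (r : ℕ) (hr : 0 < r) :
    (Finset.univ.filter fun t : Fin (2 * r) → ι =>
      ∀ j, Even (Finset.univ.filter fun i => t i = j).card).card ≤
      Fintype.card ι ^ r * r ^ (2 * r) := by
  classical
  have hcard : Fintype.card ι ^ r * r ^ (2 * r) =
      (Finset.univ : Finset ((Fin r → ι) × (Fin (2 * r) → Fin r))).card := by
    simp
  rw [hcard]
  refine Finset.card_le_card_of_surjOn (fun q i => q.1 (q.2 i)) fun t ht => ?_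
  simp only [Finset.coe_filter, Finset.mem_univ, true_and, Set.mem_ofPred_eq] at ht
  have him : (Finset.univ.image t).card ≤ r := by
    have h1 := Finset.card_eq_sum_card_image t Finset.univ
    have h2 : ∑ j ∈ Finset.univ.image t, 2 ≤
        ∑ j ∈ Finset.univ.image t, (Finset.univ.filter fun i => t i = j).card := by
      refine Finset.sum_le_sum fun j hj => ?_
      obtain ⟨i, -, hi⟩ := Finset.mem_image.1 hj
      have h3 : 0 < (Finset.univ.filter fun i => t i = j).card :=
        Finset.card_pos.2 ⟨i, by simp [hi]⟩
      obtain ⟨k, hk⟩ := ht j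
      omega
    rw [← h1] at h2
    simp only [Finset.sum_const, smul_eq_mul, Finset.card_univ, Fintype.card_fin] at h2
    omega
  set e := (Finset.univ.image t).equivFin
  have hmem : ∀ i, t i ∈ Finset.univ.image t := fun i => Finset.mem_image_of_mem _ (by simp)
  refine ⟨(fun j => if h : (j : ℕ) < (Finset.univ.image t).card then (e.symm ⟨j, h⟩ : ι)
    else t ⟨0, by omega⟩, fun i => Fin.castLE him (e ⟨t i, hmem i⟩)), by simp, ?_⟩
  funext i
  simp

lemma moment_le (hp2 : p ≠ 2) {ι : Type*} [Fintype ι] (c : ι → ZMod p)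
    (hc : Function.Injective c) (hc0 : ∀ i, c i ≠ 0) (r : ℕ) (hr : 0 < r) :
    ∑ u : ZMod p, (∑ i, qchar p (u + c i)) ^ (2 * r) ≤
      (Fintype.card ι : ℝ) ^ r * r ^ (2 * r) * p +
        (Fintype.card ι : ℝ) ^ (2 * r) * (27 * (2 * r + 1) * √p) := by
  classical
  simp_rw [Fintype.sum_pow]
  rw [Finset.sum_comm]
  rw [← Finset.sum_filter_add_sum_filter_not Finset.univ (fun t : Fin (2 * r) → ι =>
      ∀ j, Even (Finset.univ.filter fun i => t i = j).card)]
  refine add_le_add ?_ ?_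
  · have hle : ∀ t : Fin (2 * r) → ι, ∑ u : ZMod p, ∏ i, qchar p (u + c (t i)) ≤ p := fun t => by
      calc ∑ u : ZMod p, ∏ i, qchar p (u + c (t i)) ≤ ∑ u : ZMod p, 1 := by
            refine Finset.sum_le_sum fun u _ => (le_abs_self _).trans ?_
            rw [Finset.abs_prod]
            exact Finset.prod_le_one (fun i _ => abs_nonneg _) fun i _ => abs_qchar_le _
        _ = p := by simp [ZMod.card]
    refine (Finset.sum_le_card_nsmul _ _ _ fun t _ => hle t).trans ?_
    rw [nsmul_eq_mul]
    refine mul_le_mul_of_nonneg_right ?_ (by positivity)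
    exact_mod_cast card_even_fibers_le r hr
  · have hle : ∀ t ∈ Finset.univ.filter (fun t : Fin (2 * r) → ι =>
        ¬ ∀ j, Even (Finset.univ.filter fun i => t i = j).card),
        ∑ u : ZMod p, ∏ i, qchar p (u + c (t i)) ≤ 27 * (2 * r + 1) * √p := fun t ht => by
      obtain ⟨j, hj⟩ := not_forall.1 (Finset.mem_filter.1 ht).2
      have := sum_prod_qchar_le hp2 c hc hc0 _ t j (Nat.not_even_iff_odd.1 hj)
      exact_mod_cast this
    refine (Finset.sum_le_card_nsmul _ _ _ hle).trans ?_
    rw [nsmul_eq_mul]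
    refine mul_le_mul_of_nonneg_right ?_ (by positivity)
    have h1 : (Finset.univ.filter (fun t : Fin (2 * r) → ι =>
        ¬ ∀ j, Even (Finset.univ.filter fun i => t i = j).card)).card ≤
        Fintype.card ι ^ (2 * r) := by
      refine (Finset.card_filter_le _ _).trans ?_
      simp
    exact_mod_cast h1

end Moments

section Energy

open Finset

lemma sum_inv_Icc_filter_dvd_le (A d : ℕ) (hd : 0 < d) :
    ∑ a ∈ (Icc 1 A).filter (d ∣ ·), (a : ℝ)⁻¹ ≤ (d : ℝ)⁻¹ * ∑ b ∈ Icc 1 A, (b : ℝ)⁻¹ := by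
  have hsub : (Icc 1 A).filter (d ∣ ·) ⊆ (Icc 1 A).image (d * ·) := fun a ha => by
    obtain ⟨h1, b, rfl⟩ := mem_filter.1 ha
    rw [mem_Icc] at h1
    refine mem_image.2 ⟨b, mem_Icc.2 ⟨?_, ?_⟩, rfl⟩
    · exact Nat.pos_of_mul_pos_left (by omega : 0 < d * b)
    · exact (Nat.le_mul_of_pos_left b hd).trans h1.2
  refine (sum_le_sum_of_subset_of_nonneg hsub fun _ _ _ => by positivity).trans ?_
  rw [sum_image fun x _ y _ h => Nat.eq_of_mul_eq_mul_left hd h, mul_sum]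
  refine sum_le_sum fun b _ => ?_
  push_cast
  rw [mul_inv]

lemma card_Icc_filter_dvd (A d : ℕ) : ((Icc 1 A).filter (d ∣ ·)).card = A / d :=
  Nat.Ioc_filter_dvd_card_eq_div A d

lemma sum_gcd_div_le (A : ℕ) :
    ∑ a ∈ Icc 1 A, ∑ a' ∈ Icc 1 A, (Nat.gcd a a' : ℝ) / a ≤
      A * (∑ b ∈ Icc 1 A, (b : ℝ)⁻¹) ^ 2 := by
  set H := ∑ b ∈ Icc 1 A, (b : ℝ)⁻¹ with hH
  have hH0 : 0 ≤ H := sum_nonneg fun _ _ => by positivity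
  calc ∑ a ∈ Icc 1 A, ∑ a' ∈ Icc 1 A, (Nat.gcd a a' : ℝ) / a
      ≤ ∑ a ∈ Icc 1 A, ∑ a' ∈ Icc 1 A, ∑ d ∈ Icc 1 A,
          (d : ℝ) * ((if d ∣ a then (a : ℝ)⁻¹ else 0) * (if d ∣ a' then 1 else 0)) := by
        refine sum_le_sum fun a ha => sum_le_sum fun a' ha' => ?_
        rw [mem_Icc] at ha ha'
        have hg : Nat.gcd a a' ∈ Icc 1 A := mem_Icc.2
          ⟨Nat.gcd_pos_of_pos_left _ ha.1, (Nat.gcd_le_left _ ha.1).trans ha.2⟩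
        refine le_trans (le_of_eq ?_) (single_le_sum (fun d _ => ?_) hg)
        · rw [if_pos (Nat.gcd_dvd_left _ _), if_pos (Nat.gcd_dvd_right _ _), mul_one]
          rfl
        · positivity
    _ = ∑ d ∈ Icc 1 A, (d : ℝ) * ((∑ a ∈ (Icc 1 A).filter (d ∣ ·), (a : ℝ)⁻¹) *
          ((Icc 1 A).filter (d ∣ ·)).card) := by
        rw [sum_congr rfl fun a _ => sum_comm, sum_comm]
        refine sum_congr rfl fun d _ => ?_
        rw [sum_filter, natCast_card_filter, sum_mul_sum, mul_sum]
        refine sum_congr rfl fun a _ => ?_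
        rw [mul_sum]
    _ ≤ ∑ d ∈ Icc 1 A, (d : ℝ) * (((d : ℝ)⁻¹ * H) * (A * (d : ℝ)⁻¹)) := by
        refine sum_le_sum fun d hd => ?_
        have hd1 := (mem_Icc.1 hd).1
        refine mul_le_mul_of_nonneg_left ?_ (by positivity)
        refine mul_le_mul (sum_inv_Icc_filter_dvd_le A d hd1) ?_ (by positivity) (by positivity)
        rw [card_Icc_filter_dvd, ← div_eq_mul_inv]
        exact Nat.cast_div_le
    _ = A * H ^ 2 := by
        rw [sq, ← mul_assoc, hH, mul_sum _ _ ((A : ℝ) * _)]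
        refine sum_congr rfl fun d hd => ?_
        have hd1 : (d : ℝ) ≠ 0 := by
          have := (mem_Icc.1 hd).1
          positivity
        field_simp

lemma card_proportional_le (N a a' : ℕ) (ha : 0 < a) :
    ∑ n ∈ Icc 1 N, ∑ n' ∈ Icc 1 N, (if n * a' = n' * a then (1 : ℝ) else 0) ≤
      N * ((Nat.gcd a a' : ℝ) / a) := by
  set g := Nat.gcd a a' with hg
  have hgpos : 0 < g := Nat.gcd_pos_of_pos_left _ ha
  have hga : g ∣ a := Nat.gcd_dvd_left _ _
  calc ∑ n ∈ Icc 1 N, ∑ n' ∈ Icc 1 N, (if n * a' = n' * a then (1 : ℝ) else 0)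
      ≤ ∑ n ∈ Icc 1 N, (if a / g ∣ n then (1 : ℝ) else 0) := by
        refine sum_le_sum fun n _ => ?_
        split_ifs with h
        · rw [← natCast_card_filter]
          have : ((Icc 1 N).filter fun n' => n * a' = n' * a).card ≤ 1 := by
            rw [card_le_one]
            intro x hx y hy
            have h1 := (mem_filter.1 hx).2
            have h2 := (mem_filter.1 hy).2
            exact Nat.eq_of_mul_eq_mul_right ha (h1.symm.trans h2)
          exact_mod_cast this
        · refine (sum_eq_zero fun n' _ => if_neg fun heq => h ?_).le
          have h1 : a / g ∣ n * (a' / g) := by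
            rw [← Nat.mul_div_assoc _ (Nat.gcd_dvd_right _ _), heq, Nat.mul_div_assoc _ hga]
            exact dvd_mul_left _ _
          exact (Nat.coprime_div_gcd_div_gcd hgpos).dvd_of_dvd_mul_right h1
    _ = ((N / (a / g) : ℕ) : ℝ) := by rw [← natCast_card_filter, card_Icc_filter_dvd]
    _ ≤ (N : ℝ) / (a / g : ℕ) := Nat.cast_div_le
    _ = N * ((g : ℝ) / a) := by
        rw [Nat.cast_div hga (by positivity)]
        field_simp

lemma sum_inv_Icc_le (A : ℕ) : ∑ b ∈ Icc 1 A, (b : ℝ)⁻¹ ≤ 1 + Real.log A := by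
  have := harmonic_le_one_add_log A
  rw [harmonic_eq_sum_Icc] at this
  push_cast at this
  exact this

/-- Multiplicative energy of two initial intervals. -/
lemma energy_le {p : ℕ} [hp : Fact p.Prime] (A N : ℕ) (hAN : N * A < p) :
    ∑ u : ZMod p, (((Icc 1 A ×ˢ Icc 1 N).filter fun q =>
      (q.2 : ZMod p) / (q.1 : ZMod p) = u).card : ℝ) ^ 2 ≤
      N * (A * (1 + Real.log A) ^ 2) := by
  classical
  set I := Icc 1 A ×ˢ Icc 1 N
  have h1 : ∀ u : ZMod p, ((I.filter fun q => (q.2 : ZMod p) / (q.1 : ZMod p) = u).card : ℝ) ^ 2 =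
      ∑ i ∈ I, ∑ j ∈ I, if (i.2 : ZMod p) / (i.1 : ZMod p) = u then
        (if (j.2 : ZMod p) / (j.1 : ZMod p) = u then (1 : ℝ) else 0) else 0 := fun u => by
    rw [sq, natCast_card_filter, sum_mul_sum]
    refine sum_congr rfl fun i _ => sum_congr rfl fun j _ => ?_
    split_ifs <;> simp
  have hlt : ∀ n a : ℕ, n ∈ Icc 1 N → a ∈ Icc 1 A → n * a < p := fun n a hn ha =>
    lt_of_le_of_lt (Nat.mul_le_mul (mem_Icc.1 hn).2 (mem_Icc.1 ha).2) hAN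
  have hne : ∀ a ∈ Icc 1 A, N ≠ 0 → (a : ZMod p) ≠ 0 := fun a ha hN => by
    rw [Ne, ZMod.natCast_eq_zero_iff]
    have h2 := mem_Icc.1 ha
    have h3 := hlt 1 a (mem_Icc.2 ⟨le_rfl, Nat.pos_of_ne_zero hN⟩) ha
    exact Nat.not_dvd_of_pos_of_lt h2.1 (by simpa using h3)
  calc _ = ∑ i ∈ I, ∑ j ∈ I, (if (j.2 : ZMod p) / (j.1 : ZMod p) =
          (i.2 : ZMod p) / (i.1 : ZMod p) then (1 : ℝ) else 0) := by
        rw [sum_congr rfl fun u _ => h1 u, sum_comm]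
        refine sum_congr rfl fun i _ => ?_
        rw [sum_comm]
        refine sum_congr rfl fun j _ => ?_
        simp
    _ ≤ ∑ i ∈ I, ∑ j ∈ I, (if i.2 * j.1 = j.2 * i.1 then (1 : ℝ) else 0) := by
        refine sum_le_sum fun i hi => sum_le_sum fun j hj => ?_
        obtain ⟨hi1, hi2⟩ := mem_product.1 hi
        obtain ⟨hj1, hj2⟩ := mem_product.1 hj
        have hN : N ≠ 0 := by have := mem_Icc.1 hi2; omega
        split_ifs with h3 h4
        · exact le_rfl
        · exfalso
          rw [div_eq_div_iff (hne _ hj1 hN) (hne _ hi1 hN)] at h3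
          have h5 : ((j.2 * i.1 : ℕ) : ZMod p) = ((i.2 * j.1 : ℕ) : ZMod p) := by
            push_cast; exact h3
          have h6 := (ZMod.natCast_eq_natCast_iff' _ _ _).1 h5
          rw [Nat.mod_eq_of_lt (hlt _ _ hj2 hi1), Nat.mod_eq_of_lt (hlt _ _ hi2 hj1)] at h6
          exact h4 h6.symm
        · norm_num
        · exact le_rfl
    _ = ∑ a ∈ Icc 1 A, ∑ a' ∈ Icc 1 A, ∑ n ∈ Icc 1 N, ∑ n' ∈ Icc 1 N,
          (if n * a' = n' * a then (1 : ℝ) else 0) := by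
        rw [sum_product]
        refine sum_congr rfl fun a _ => ?_
        simp only [I, sum_product]
        rw [sum_comm]
    _ ≤ ∑ a ∈ Icc 1 A, ∑ a' ∈ Icc 1 A, N * ((Nat.gcd a a' : ℝ) / a) :=
        sum_le_sum fun a ha => sum_le_sum fun a' _ => card_proportional_le N a a' (mem_Icc.1 ha).1
    _ = N * ∑ a ∈ Icc 1 A, ∑ a' ∈ Icc 1 A, ((Nat.gcd a a' : ℝ) / a) := by
        simp_rw [mul_sum]
    _ ≤ N * (A * (1 + Real.log A) ^ 2) := by
        refine mul_le_mul_of_nonneg_left ((sum_gcd_div_le A).trans ?_) (by positivity)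
        have h7 := sum_inv_Icc_le A
        have h8 : 0 ≤ ∑ b ∈ Icc 1 A, (b : ℝ)⁻¹ := sum_nonneg fun _ _ => by positivity
        gcongr

lemma sum_Icc_shift_one (g : ℕ → ℝ) (N : ℕ) :
    ∑ n ∈ Icc 1 N, g n + g (N + 1) = g 1 + ∑ n ∈ Icc 1 N, g (n + 1) := by
  induction N with
  | zero => simp
  | succ N ih =>
    rw [sum_Icc_succ_top (by omega), sum_Icc_succ_top (by omega), ← add_assoc, ← ih]

lemma sum_Icc_le_sum_shift (g : ℕ → ℝ) (hg : ∀ n, |g n| ≤ 1) (N m : ℕ) :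
    ∑ n ∈ Icc 1 N, g n ≤ ∑ n ∈ Icc 1 N, g (n + m) + 2 * m := by
  induction m with
  | zero => simp
  | succ m ih =>
    have h1 := sum_Icc_shift_one (fun n => g (n + m)) N
    have h2 := abs_le.1 (hg (1 + m))
    have h3 := abs_le.1 (hg (N + 1 + m))
    have h4 : ∀ n, n + 1 + m = n + (m + 1) := fun n => by ring
    simp only [h4] at h1 h3
    push_cast
    rw [h4 0, zero_add] at h2
    have h5 : g (0 + (m + 1)) = g (m + 1) := by rw [zero_add]
    linarith [h2.2, h3.1]

/-- Burgess's inequality with explicit parameters. -/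
lemma burgess_finite {p : ℕ} [hp : Fact p.Prime] (hp2 : p ≠ 2) (N A B r : ℕ)
    (hNA : N * A < p) (hA : A < p) (hB : B < p) :
    ∃ X : ℝ, 0 ≤ X ∧
      (A * B : ℝ) * ∑ n ∈ Icc 1 N, qchar p (n : ZMod p) ≤ X + 2 * (A * B) ^ 2 ∧
      X ^ (2 * (r + 1)) ≤ (A * N : ℝ) ^ (2 * r) * ((N * (A * (1 + Real.log A) ^ 2)) *
        ((B : ℝ) ^ (r + 1) * (r + 1) ^ (2 * (r + 1)) * p +
          (B : ℝ) ^ (2 * (r + 1)) * (27 * (2 * (r + 1) + 1) * √p))) := by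
  classical
  set I := Icc 1 A ×ˢ Icc 1 N
  set φ : ℕ × ℕ → ZMod p := fun q => (q.2 : ZMod p) / (q.1 : ZMod p) with hφ
  set T : ZMod p → ℝ := fun u => ∑ i : Fin B, qchar p (u + ((i + 1 : ℕ) : ZMod p)) with hT
  have hcast : ∀ i : Fin B, (i : ℕ) + 1 < p := fun i => by have := i.2; omega
  refine ⟨∑ q ∈ I, |T (φ q)|, sum_nonneg fun _ _ => abs_nonneg _, ?_, ?_⟩
  · have h1 : ∀ a ∈ Icc 1 A, ∀ b : Fin B, ∑ n ∈ Icc 1 N, qchar p (n : ZMod p) ≤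
        ∑ n ∈ Icc 1 N, qchar p ((n + a * (b + 1) : ℕ) : ZMod p) + 2 * (A * B) := fun a ha b => by
      refine (sum_Icc_le_sum_shift (fun n => qchar p (n : ZMod p)) (fun n => abs_qchar_le _) N
        (a * (b + 1))).trans (add_le_add le_rfl ?_)
      have h2 : a * ((b : ℕ) + 1) ≤ A * B := Nat.mul_le_mul (mem_Icc.1 ha).2 b.2
      have h3 : ((a * ((b : ℕ) + 1) : ℕ) : ℝ) ≤ A * B := by exact_mod_cast h2
      linarith
    calc (A * B : ℝ) * ∑ n ∈ Icc 1 N, qchar p (n : ZMod p)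
        = ∑ a ∈ Icc 1 A, ∑ b : Fin B, ∑ n ∈ Icc 1 N, qchar p (n : ZMod p) := by
          simp [mul_assoc]
      _ ≤ ∑ a ∈ Icc 1 A, ∑ b : Fin B,
            (∑ n ∈ Icc 1 N, qchar p ((n + a * (b + 1) : ℕ) : ZMod p) + 2 * (A * B)) :=
          sum_le_sum fun a ha => sum_le_sum fun b _ => h1 a ha b
      _ = ∑ a ∈ Icc 1 A, ∑ n ∈ Icc 1 N, ∑ b : Fin B,
            qchar p ((n + a * (b + 1) : ℕ) : ZMod p) + 2 * (A * B) ^ 2 := by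
          simp only [sum_add_distrib, sum_const, card_univ, Fintype.card_fin, Nat.card_Icc,
            nsmul_eq_mul, Nat.add_sub_cancel]
          congr 1
          · exact sum_congr rfl fun a _ => sum_comm
          · ring
      _ ≤ ∑ a ∈ Icc 1 A, ∑ n ∈ Icc 1 N, |T (φ (a, n))| + 2 * (A * B) ^ 2 := by
          refine add_le_add (sum_le_sum fun a ha => sum_le_sum fun n _ => ?_) le_rfl
          have ha0 : (a : ZMod p) ≠ 0 := by
            rw [Ne, ZMod.natCast_eq_zero_iff]
            have := mem_Icc.1 ha
            exact Nat.not_dvd_of_pos_of_lt this.1 (by omega)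
          have h2 : ∑ b : Fin B, qchar p ((n + a * (b + 1) : ℕ) : ZMod p) =
              qchar p a * T (φ (a, n)) := by
            rw [hT, mul_sum]
            refine sum_congr rfl fun b _ => ?_
            rw [← qchar_mul]
            congr 1
            simp only [hφ]
            push_cast
            field_simp
          rw [h2]
          refine (le_abs_self _).trans ?_
          rw [abs_mul, abs_qchar_of_ne_zero ha0, one_mul]
      _ = _ := by rw [sum_product]
  · have hmom := moment_le hp2 (fun i : Fin B => ((i + 1 : ℕ) : ZMod p)) (fun i j hij => by
      have h := (ZMod.natCast_eq_natCast_iff' _ _ _).1 hij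
      rw [Nat.mod_eq_of_lt (hcast i), Nat.mod_eq_of_lt (hcast j)] at h
      exact Fin.ext (by omega)) (fun i => by
      rw [Ne, ZMod.natCast_eq_zero_iff]
      exact Nat.not_dvd_of_pos_of_lt (by omega) (hcast i)) (r + 1) (by omega)
    rw [Fintype.card_fin] at hmom
    have hen := energy_le A N hNA
    set ν : ZMod p → ℝ := fun u => ((I.filter fun q => φ q = u).card : ℝ) with hν
    have hX : (∑ q ∈ I, |T (φ q)|) ^ (r + 1) ≤
        (A * N : ℝ) ^ r * ∑ q ∈ I, |T (φ q)| ^ (r + 1) := by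
      rcases I.eq_empty_or_nonempty with h0 | h0
      · simp [h0]
      · have h2 := pow_sum_div_card_le_sum_pow (s := I) (f := fun q => |T (φ q)|)
          (fun q _ => abs_nonneg _) r
        have hc : (0 : ℝ) < (I.card : ℝ) ^ r := by
          have := h0.card_pos
          positivity
        rw [div_le_iff₀ hc] at h2
        refine h2.trans (le_of_eq ?_)
        rw [mul_comm]
        simp [I]
    have hY : ∑ q ∈ I, |T (φ q)| ^ (r + 1) = ∑ u, ν u * |T u| ^ (r + 1) := by
      rw [← sum_fiberwise I φ]
      refine sum_congr rfl fun u _ => ?_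
      rw [sum_congr rfl (g := fun _ => |T u| ^ (r + 1)) fun q hq => by
        rw [(mem_filter.1 hq).2]]
      simp [ν]
    have hCS : (∑ u, ν u * |T u| ^ (r + 1)) ^ 2 ≤
        (∑ u, ν u ^ 2) * ∑ u, T u ^ (2 * (r + 1)) := by
      refine (sum_mul_sq_le_sq_mul_sq univ ν fun u => |T u| ^ (r + 1)).trans (le_of_eq ?_)
      congr 1
      refine sum_congr rfl fun u _ => ?_
      rw [← pow_mul, mul_comm (r + 1) 2, pow_mul, sq_abs, ← pow_mul]
    calc (∑ q ∈ I, |T (φ q)|) ^ (2 * (r + 1))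
        = ((∑ q ∈ I, |T (φ q)|) ^ (r + 1)) ^ 2 := by rw [← pow_mul, mul_comm]
      _ ≤ ((A * N : ℝ) ^ r * ∑ q ∈ I, |T (φ q)| ^ (r + 1)) ^ 2 := by
          refine pow_le_pow_left₀ ?_ hX 2
          exact pow_nonneg (sum_nonneg fun _ _ => abs_nonneg _) _
      _ = (A * N : ℝ) ^ (2 * r) * (∑ u, ν u * |T u| ^ (r + 1)) ^ 2 := by
          rw [hY, mul_pow, ← pow_mul, mul_comm r 2]
      _ ≤ _ := by
          refine mul_le_mul_of_nonneg_left (hCS.trans ?_) (by positivity)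
          refine mul_le_mul hen ?_ (sum_nonneg fun u _ => ?_) (by positivity)
          · refine hmom.trans (le_of_eq ?_)
            push_cast
            ring
          · exact (even_two_mul _).pow_nonneg _

end Energy

end BeattyNonresidue

namespace BeattyNonresidue

open Finset Filter

lemma eventually_one_add_log_sq_le (c δ : ℝ) (hc : 0 < c) (hδ : 0 < δ) :
    ∀ᶠ x : ℝ in atTop, (1 + Real.log x) ^ 2 ≤ c * x ^ δ := by
  have hs : 0 < √c / 2 := by positivity
  have h1 := (isLittleO_log_rpow_atTop (half_pos hδ)).def hs
  have h2 := (tendsto_rpow_atTop (half_pos hδ)).eventually_ge_atTop (√c / 2)⁻¹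
  filter_upwards [h1, h2, eventually_ge_atTop 1] with x hx1 hx2 hx3
  have hlog := Real.log_nonneg hx3
  have hpow : 0 ≤ x ^ (δ / 2) := by positivity
  rw [Real.norm_of_nonneg hlog, Real.norm_of_nonneg hpow] at hx1
  have h3 : 1 ≤ √c / 2 * x ^ (δ / 2) := by
    have := mul_le_mul_of_nonneg_left hx2 hs.le
    rwa [mul_inv_cancel₀ hs.ne'] at this
  calc (1 + Real.log x) ^ 2 ≤ (√c * x ^ (δ / 2)) ^ 2 := by
        gcongr
        linarith
    _ = c * x ^ δ := by
        rw [mul_pow, Real.sq_sqrt hc.le, ← Real.rpow_natCast, ← Real.rpow_mul (by linarith)]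
        norm_num

lemma burgess_of_parameters {p : ℕ} [hp : Fact p.Prime] (hp2 : p ≠ 2) (N A B r : ℕ) (η : ℝ)
    (hη : 0 < η) (hNA : N * A < p) (hAp : A < p) (hBp : B < p) (hA0 : (0 : ℝ) < A)
    (hB0 : (0 : ℝ) < B) (hA1 : (A : ℝ) * B ≤ η * N) (hBR : √p ≤ (B : ℝ) ^ (r + 1))
    (hkey : (1 + Real.log A) ^ 2 *
      ((((r + 1 : ℕ) : ℝ) ^ (2 * (r + 1)) + 27 * (2 * ((r + 1 : ℕ) : ℝ) + 1)) * √p) ≤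
        η ^ (2 * (r + 1)) * (A * N)) :
    ∑ n ∈ Icc 1 N, qchar p (n : ZMod p) ≤ 3 * η * N := by
  obtain ⟨X, hX0, hS, hX⟩ := burgess_finite hp2 N A B r hNA hAp hBp
  set R := r + 1 with hR
  set P : ℝ := (p : ℝ) with hP
  have hP0 : 0 ≤ P := by positivity
  set K : ℝ := (R : ℝ) ^ (2 * R) + 27 * (2 * R + 1) with hK
  have hmom : (B : ℝ) ^ R * R ^ (2 * R) * P + (B : ℝ) ^ (2 * R) * (27 * (2 * R + 1) * √P) ≤
      (B : ℝ) ^ (2 * R) * (K * √P) := by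
    have h5 : P ≤ (B : ℝ) ^ R * √P := by
      calc P = √P * √P := (Real.mul_self_sqrt hP0).symm
        _ ≤ _ := by gcongr
    have h6 : (B : ℝ) ^ R * R ^ (2 * R) * P ≤ (B : ℝ) ^ R * R ^ (2 * R) * ((B : ℝ) ^ R * √P) := by
      gcongr
    have h7 : (B : ℝ) ^ R * R ^ (2 * R) * ((B : ℝ) ^ R * √P) =
        (B : ℝ) ^ (2 * R) * (R ^ (2 * R) * √P) := by ring
    rw [hK]
    linarith
  have hXle : X ≤ η * (A * N * B) := by
    refine le_of_pow_le_pow_left₀ (n := 2 * R) (by omega) (by positivity) (hX.trans ?_)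
    have hRc : ((r : ℝ) + 1) = (R : ℝ) := by rw [hR]; push_cast; ring
    rw [hRc]
    calc (A * N : ℝ) ^ (2 * r) * ((N * (A * (1 + Real.log A) ^ 2)) *
          ((B : ℝ) ^ R * R ^ (2 * R) * P + (B : ℝ) ^ (2 * R) * (27 * (2 * R + 1) * √P)))
        ≤ (A * N : ℝ) ^ (2 * r) * ((N * (A * (1 + Real.log A) ^ 2)) *
          ((B : ℝ) ^ (2 * R) * (K * √P))) := by gcongr
      _ = (A * N : ℝ) ^ (2 * r) * (A * N) * (B : ℝ) ^ (2 * R) *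
          ((1 + Real.log A) ^ 2 * (K * √P)) := by ring
      _ ≤ (A * N : ℝ) ^ (2 * r) * (A * N) * (B : ℝ) ^ (2 * R) *
          (η ^ (2 * R) * (A * N)) := by gcongr
      _ = (η * (A * N * B)) ^ (2 * R) := by
          have : (A * N : ℝ) ^ (2 * R) = (A * N : ℝ) ^ (2 * r) * (A * N) * (A * N) := by
            rw [hR]; ring
          rw [mul_pow η, mul_pow (A * N : ℝ) (B : ℝ), this]; ring
  have hAB : (0 : ℝ) < A * B := by positivity
  refine le_of_mul_le_mul_left ?_ hAB
  nlinarith [mul_le_mul_of_nonneg_left hA1 hAB.le]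

/-- Burgess's bound for initial intervals. -/
theorem burgess (δ η : ℝ) (hδ : 0 < δ) (hδ' : δ ≤ 1 / 8) (hη : 0 < η) (hη' : η ≤ 1) :
    ∀ᶠ p : ℕ in atTop, ∀ _ : Fact p.Prime, ∀ N : ℕ, (p : ℝ) ^ (1 / 4 + δ) ≤ N →
      (N : ℝ) ≤ 2 * (p : ℝ) ^ (1 / 4 + δ) →
        ∑ n ∈ Icc 1 N, qchar p (n : ZMod p) ≤ 3 * η * N := by
  obtain ⟨r, hr⟩ := exists_nat_gt (1 / (2 * δ))
  set R := r + 1 with hR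
  set σ : ℝ := 1 / (2 * R) with hσ
  have hRpos : (0 : ℝ) < R := by positivity
  have hσ0 : 0 < σ := by positivity
  have hσδ : σ ≤ δ := by
    rw [hσ, div_le_iff₀ (by positivity)]
    rw [div_lt_iff₀ (by positivity)] at hr
    have : (R : ℝ) = r + 1 := by rw [hR]; push_cast; ring
    nlinarith
  set K : ℝ := (R : ℝ) ^ (2 * R) + 27 * (2 * R + 1) with hK
  have hKpos : 0 < K := by positivity
  have e1 := eventually_one_add_log_sq_le (η ^ (2 * R) * (η / 4) / K) δ (by positivity) hδ
  have e2 := (tendsto_rpow_atTop (show (0 : ℝ) < 1 / 4 by norm_num)).eventually_gt_atTop (4 / η)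
  have hcast := tendsto_natCast_atTop_atTop (R := ℝ)
  filter_upwards [hcast.eventually e1, hcast.eventually e2, eventually_ge_atTop 3]
    with p h1 h2 h3 hp N hN1 hN2
  set P : ℝ := (p : ℝ) with hP
  have hP1 : 1 ≤ P := by rw [hP]; exact_mod_cast (by omega : 1 ≤ p)
  have hP0 : 0 < P := by linarith
  have h4 : 4 < P ^ (1 / 4 : ℝ) := lt_of_le_of_lt (by rw [le_div_iff₀ hη]; linarith) h2
  have hmono : ∀ {a b : ℝ}, a ≤ b → P ^ a ≤ P ^ b := fun h => Real.rpow_le_rpow_of_exponent_le hP1 h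
  have hN0 : (0 : ℝ) < N := lt_of_lt_of_le (by positivity) hN1
  set B := ⌈P ^ σ⌉₊ with hB
  have hPσ1 : 1 ≤ P ^ σ := Real.one_le_rpow hP1 hσ0.le
  have hB1 : P ^ σ ≤ B := Nat.le_ceil _
  have hB2 : (B : ℝ) ≤ 2 * P ^ σ := by
    have := Nat.ceil_lt_add_one (by positivity : 0 ≤ P ^ σ)
    linarith
  have hB0 : (0 : ℝ) < B := by linarith
  have hB1' : (1 : ℝ) ≤ B := by linarith
  have hBR : √P ≤ (B : ℝ) ^ R := by
    calc √P = (P ^ σ) ^ R := by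
          rw [Real.sqrt_eq_rpow, ← Real.rpow_natCast, ← Real.rpow_mul hP0.le, hσ]
          congr 1
          field_simp
      _ ≤ (B : ℝ) ^ R := by gcongr
  set A := ⌊η * N / B⌋₊ with hA
  have hA1 : (A : ℝ) * B ≤ η * N := by
    rw [← le_div_iff₀ hB0]
    exact Nat.floor_le (by positivity)
  have hNB : 2 ≤ η * N / B := by
    rw [le_div_iff₀ hB0]
    have h5 : P ^ (1 / 4 : ℝ) * P ^ σ ≤ N := by
      rw [← Real.rpow_add hP0]
      exact (hmono (by linarith)).trans hN1
    have h6 : 4 < η * P ^ (1 / 4 : ℝ) := by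
      rw [div_lt_iff₀ hη] at h2; linarith
    calc 2 * (B : ℝ) ≤ 4 * P ^ σ := by linarith
      _ ≤ η * P ^ (1 / 4 : ℝ) * P ^ σ := by gcongr
      _ = η * (P ^ (1 / 4 : ℝ) * P ^ σ) := by ring
      _ ≤ η * N := by gcongr
  have hA2 : η * N / B ≤ 2 * A := by
    have := Nat.lt_floor_add_one (η * N / B)
    rw [← hA] at this
    linarith
  have hA0 : (0 : ℝ) < A := by linarith
  have hAN' : (A : ℝ) ≤ N := by nlinarith
  have hANlow : η / 4 * P ^ (1 / 2 + δ) ≤ A * N := by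
    have h5 : η * N ≤ 4 * (A * P ^ σ) := by
      rw [div_le_iff₀ hB0] at hA2
      nlinarith
    have h6 : P ^ (1 / 2 + δ) * P ^ σ ≤ (N : ℝ) * N := by
      calc P ^ (1 / 2 + δ) * P ^ σ ≤ P ^ (1 / 4 + δ) * P ^ (1 / 4 + δ) := by
            rw [← Real.rpow_add hP0, ← Real.rpow_add hP0]
            exact hmono (by linarith)
        _ ≤ N * N := by gcongr
    have hPσ : 0 < P ^ σ := by positivity
    refine le_of_mul_le_mul_right ?_ hPσ
    nlinarith [mul_le_mul_of_nonneg_left h6 hη.le, mul_le_mul_of_nonneg_right h5 hN0.le]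
  have hNN : (N : ℝ) * N < P := by
    calc (N : ℝ) * N ≤ (2 * P ^ (1 / 4 + δ)) * (2 * P ^ (1 / 4 + δ)) := by gcongr
      _ = 4 * P ^ (1 / 2 + 2 * δ) := by
          rw [mul_mul_mul_comm, ← Real.rpow_add hP0]
          ring_nf
      _ ≤ 4 * P ^ (3 / 4 : ℝ) := by
          refine mul_le_mul_of_nonneg_left (hmono (by linarith)) (by norm_num)
      _ < P ^ (1 / 4 : ℝ) * P ^ (3 / 4 : ℝ) := by gcongr
      _ = P := by rw [← Real.rpow_add hP0]; norm_num
  have hN1' : (1 : ℝ) ≤ N := by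
    have : 0 < N := by exact_mod_cast hN0
    exact_mod_cast this
  have hNA : N * A < p := by
    have : (N : ℝ) * A < p := lt_of_le_of_lt (by gcongr) hNN
    exact_mod_cast this
  have hAp : A < p := by
    have h5 : (A : ℝ) ≤ N * A := le_mul_of_one_le_left hA0.le hN1'
    have h6 : (N : ℝ) * A < p := by exact_mod_cast hNA
    exact_mod_cast h5.trans_lt h6
  have hBp : B < p := by
    have h5 : (B : ℝ) ≤ N := by
      rw [le_div_iff₀ hB0] at hNB
      have h6 : η * (N : ℝ) ≤ 1 * N := mul_le_mul_of_nonneg_right hη' hN0.le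
      linarith
    have h6 : (N : ℝ) ≤ N * N := le_mul_of_one_le_left hN0.le hN1'
    have h7 := (h5.trans h6).trans_lt hNN
    rw [hP] at h7
    exact_mod_cast h7
  have hlogA : 1 + Real.log A ≤ 1 + Real.log P := by
    have : (A : ℝ) ≤ P := by rw [hP]; exact_mod_cast hAp.le
    gcongr
  have hlogA0 : 0 ≤ 1 + Real.log A := by
    have : 1 ≤ A := by exact_mod_cast hA0
    have := Real.log_nonneg (by exact_mod_cast this : (1 : ℝ) ≤ A)
    linarith
  have hkey : (1 + Real.log A) ^ 2 * (K * √P) ≤ η ^ (2 * R) * (A * N) := by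
    calc (1 + Real.log A) ^ 2 * (K * √P) ≤ (1 + Real.log P) ^ 2 * (K * √P) := by gcongr
      _ ≤ (η ^ (2 * R) * (η / 4) / K * P ^ δ) * (K * √P) := by gcongr
      _ = η ^ (2 * R) * (η / 4 * P ^ (1 / 2 + δ)) := by
          rw [Real.rpow_add hP0, ← Real.sqrt_eq_rpow]
          field_simp
      _ ≤ η ^ (2 * R) * (A * N) := by gcongr
  exact burgess_of_parameters (by omega) N A B r η hη hNA hAp hBp hA0 hB0 hA1 hBR hkey

end BeattyNonresidue

namespace BeattyNonresidue

open Finset Filter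

lemma log_factorial_eq_sum_vonMangoldt (N : ℕ) :
    Real.log N.factorial = ∑ d ∈ Icc 1 N, ArithmeticFunction.vonMangoldt d * ((N / d : ℕ) : ℝ) := by
  have h1 : Real.log N.factorial = ∑ n ∈ Icc 1 N, Real.log n := by
    rw [← Finset.prod_Ico_id_eq_factorial, Nat.cast_prod, Real.log_prod]
    · rfl
    · intro i hi
      have := (mem_Ico.mp hi).1
      positivity
  have h2 : ∀ n ∈ Icc 1 N, Real.log n =
      ∑ d ∈ Icc 1 N, if d ∣ n then ArithmeticFunction.vonMangoldt d else 0 := by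
    intro n hn
    rw [mem_Icc] at hn
    rw [← ArithmeticFunction.vonMangoldt_sum, ← sum_filter]
    refine sum_congr ?_ fun _ _ => rfl
    ext d
    simp only [Nat.mem_divisors, mem_filter, mem_Icc]
    constructor
    · rintro ⟨h, h0⟩
      exact ⟨⟨Nat.pos_of_dvd_of_pos h hn.1, (Nat.le_of_dvd hn.1 h).trans hn.2⟩, h⟩
    · rintro ⟨_, h⟩
      exact ⟨h, by omega⟩
  rw [h1, sum_congr rfl h2, sum_comm]
  refine sum_congr rfl fun d _ => ?_
  rw [← sum_filter, sum_const, card_Icc_filter_dvd, nsmul_eq_mul, mul_comm]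

lemma log_sub_one_le_sum_vonMangoldt_div (N : ℕ) (hN : 0 < N) :
    Real.log N - 1 ≤ ∑ d ∈ Icc 1 N, ArithmeticFunction.vonMangoldt d / d := by
  have h1 : N * Real.log N - N ≤ Real.log N.factorial := by
    have := Stirling.le_log_factorial_stirling hN.ne'
    have h2 : (1 : ℝ) ≤ N := by exact_mod_cast hN
    have h3 := Real.log_nonneg h2
    have h4 : 0 ≤ Real.log (2 * Real.pi) := Real.log_nonneg (by linarith [Real.pi_gt_three])
    linarith
  have h2 : Real.log N.factorial ≤ N * ∑ d ∈ Icc 1 N, ArithmeticFunction.vonMangoldt d / d := by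
    rw [log_factorial_eq_sum_vonMangoldt, mul_sum]
    refine sum_le_sum fun d _ => ?_
    have h3 : ((N / d : ℕ) : ℝ) ≤ N / d := Nat.cast_div_le
    calc _ ≤ ArithmeticFunction.vonMangoldt d * (N / d : ℝ) :=
          mul_le_mul_of_nonneg_left h3 ArithmeticFunction.vonMangoldt_nonneg
      _ = _ := by ring
  have hN' : (0 : ℝ) < N := by exact_mod_cast hN
  refine le_of_mul_le_mul_left ?_ hN'
  linarith

lemma sum_vonMangoldt_div_le (N : ℕ) (hN : 0 < N) :
    ∑ d ∈ Icc 1 N, ArithmeticFunction.vonMangoldt d / d ≤ Real.log N + (Real.log 4 + 4) := by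
  have hN' : (0 : ℝ) < N := by exact_mod_cast hN
  have h1 : Real.log N.factorial ≤ N * Real.log N := by
    rw [← Real.log_pow]
    exact Real.log_le_log (by positivity) (by exact_mod_cast Nat.factorial_le_pow N)
  have h2 : N * ∑ d ∈ Icc 1 N, ArithmeticFunction.vonMangoldt d / d ≤
      Real.log N.factorial + Chebyshev.psi N := by
    have hpsi : Chebyshev.psi N = ∑ d ∈ Icc 1 N, ArithmeticFunction.vonMangoldt d := by
      rw [Chebyshev.psi, Nat.floor_natCast]
      rfl
    rw [log_factorial_eq_sum_vonMangoldt, hpsi, mul_sum, ← sum_add_distrib]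
    refine sum_le_sum fun d hd => ?_
    have hd0 : 0 < d := (mem_Icc.mp hd).1
    have h3 : (N : ℝ) / d ≤ ((N / d : ℕ) : ℝ) + 1 := by
      rw [div_le_iff₀ (by exact_mod_cast hd0)]
      have := Nat.lt_mul_of_div_lt (Nat.lt_succ_self (N / d)) hd0
      have h4 : (N : ℝ) < ((N / d : ℕ) + 1) * d := by exact_mod_cast this
      linarith
    calc _ = ArithmeticFunction.vonMangoldt d * (N / d : ℝ) := by ring
      _ ≤ ArithmeticFunction.vonMangoldt d * (((N / d : ℕ) : ℝ) + 1) :=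
          mul_le_mul_of_nonneg_left h3 ArithmeticFunction.vonMangoldt_nonneg
      _ = _ := by ring
  have h3 := Chebyshev.psi_le_const_mul_self hN'.le
  refine le_of_mul_le_mul_left ?_ hN'
  linarith

/-- The set of primes in the interval `(u, v]`. -/
noncomputable def primesIoc (u v : ℝ) : Finset ℕ :=
  (Icc 1 ⌊v⌋₊).filter fun q => q.Prime ∧ u < q

lemma mem_primesIoc {u v : ℝ} {q : ℕ} : q ∈ primesIoc u v ↔ q.Prime ∧ u < q ∧ (q : ℝ) ≤ v := by
  simp only [primesIoc, mem_filter, mem_Icc]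
  constructor
  · rintro ⟨⟨h1, h2⟩, h3, h4⟩
    exact ⟨h3, h4, (Nat.le_floor_iff' (by omega)).mp h2⟩
  · rintro ⟨h1, h2, h3⟩
    exact ⟨⟨h1.pos, (Nat.le_floor_iff' h1.ne_zero).mpr h3⟩, h1, h2⟩

lemma sum_inv_primesIoc_le {u v : ℝ} (hu : 2 ≤ u) (huv : u ≤ v) :
    ∑ q ∈ primesIoc u v, (q : ℝ)⁻¹ ≤
      (Real.log v - Real.log u + (Real.log 2 + Real.log 4 + 5)) / Real.log u := by
  have hlu : 0 < Real.log u := Real.log_pos (by linarith)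
  have hfu : 0 < ⌊u⌋₊ := Nat.floor_pos.mpr (by linarith)
  have hfv : 0 < ⌊v⌋₊ := Nat.floor_pos.mpr (by linarith)
  have h1 := log_sub_one_le_sum_vonMangoldt_div _ hfu
  have h2 := sum_vonMangoldt_div_le _ hfv
  have h3 : Real.log ⌊v⌋₊ ≤ Real.log v :=
    Real.log_le_log (by exact_mod_cast hfv) (Nat.floor_le (by linarith))
  have h4 : Real.log u - Real.log 2 ≤ Real.log ⌊u⌋₊ := by
    rw [← Real.log_div (by linarith) (by norm_num)]
    refine Real.log_le_log (by linarith) ?_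
    have := Nat.lt_floor_add_one u
    linarith
  have hdisj : Disjoint (primesIoc u v) (Icc 1 ⌊u⌋₊) := by
    rw [disjoint_left]
    intro q hq hq'
    rw [mem_primesIoc] at hq
    have := (Nat.le_floor_iff' hq.1.ne_zero).mp (mem_Icc.mp hq').2
    linarith
  have h5 : ∑ q ∈ primesIoc u v, Real.log q / q +
      ∑ d ∈ Icc 1 ⌊u⌋₊, ArithmeticFunction.vonMangoldt d / d ≤
      ∑ d ∈ Icc 1 ⌊v⌋₊, ArithmeticFunction.vonMangoldt d / d := by
    have h6 : ∑ q ∈ primesIoc u v, Real.log q / q =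
        ∑ d ∈ primesIoc u v, ArithmeticFunction.vonMangoldt d / d := by
      refine sum_congr rfl fun q hq => ?_
      rw [ArithmeticFunction.vonMangoldt_apply_prime (mem_primesIoc.mp hq).1]
    rw [h6, ← sum_union hdisj]
    refine sum_le_sum_of_subset_of_nonneg ?_ fun d _ _ =>
      div_nonneg ArithmeticFunction.vonMangoldt_nonneg (Nat.cast_nonneg d)
    refine union_subset (filter_subset _ _) (Icc_subset_Icc_right (Nat.floor_le_floor huv))
  rw [le_div_iff₀ hlu, sum_mul]
  have h7 : ∑ q ∈ primesIoc u v, (q : ℝ)⁻¹ * Real.log u ≤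
      ∑ q ∈ primesIoc u v, Real.log q / q := by
    refine sum_le_sum fun q hq => ?_
    rw [mem_primesIoc] at hq
    rw [div_eq_inv_mul]
    have := Real.log_le_log (by linarith) hq.2.1.le
    gcongr
  linarith

lemma sum_inv_primesIoc_add {u v w : ℝ} :
    ∑ q ∈ primesIoc u w, (q : ℝ)⁻¹ ≤
      ∑ q ∈ primesIoc u v, (q : ℝ)⁻¹ + ∑ q ∈ primesIoc v w, (q : ℝ)⁻¹ := by
  have hsub : primesIoc u w ⊆ primesIoc u v ∪ primesIoc v w := by
    intro q hq
    rw [mem_primesIoc] at hq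
    rw [mem_union, mem_primesIoc, mem_primesIoc]
    rcases le_or_gt (q : ℝ) v with h | h
    · exact Or.inl ⟨hq.1, hq.2.1, h⟩
    · exact Or.inr ⟨hq.1, h, hq.2.2⟩
  refine (sum_le_sum_of_subset_of_nonneg hsub fun _ _ _ => by positivity).trans ?_
  rw [← sum_union_inter]
  have : 0 ≤ ∑ q ∈ primesIoc u v ∩ primesIoc v w, (q : ℝ)⁻¹ := sum_nonneg fun _ _ => by positivity
  linarith

/-- An upper bound of Mertens type: primes in `(y, y ^ R]` have reciprocal sum at most
`log R + o(1)`. -/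
theorem eventually_sum_inv_primes_le (R κ : ℝ) (hR : 1 < R) (hκ : 0 < κ) :
    ∀ᶠ y : ℝ in atTop, ∑ q ∈ primesIoc y (y ^ R), (q : ℝ)⁻¹ ≤ Real.log R + κ := by
  set ℓ := Real.log R with hℓ
  have hℓ0 : 0 < ℓ := Real.log_pos hR
  obtain ⟨K, hK⟩ := exists_nat_gt (max ℓ (ℓ ^ 2 / (κ / 2)))
  have hK1 : ℓ < K := (le_max_left _ _).trans_lt hK
  have hK2 : ℓ ^ 2 / (κ / 2) < K := (le_max_right _ _).trans_lt hK
  have hK0 : (0 : ℝ) < K := hℓ0.trans hK1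
  set h := ℓ / K with hh
  have hh0 : 0 < h := by positivity
  have hKh : K * h = ℓ := by rw [hh]; field_simp
  have hexp : Real.exp h - 1 ≤ h + h ^ 2 := by
    have h1 : |h| ≤ 1 := by rw [abs_of_pos hh0, hh, div_le_one hK0]; exact hK1.le
    have := (abs_le.mp (Real.abs_exp_sub_one_sub_id_le h1)).2
    linarith
  have hKexp : K * (Real.exp h - 1) ≤ ℓ + κ / 2 := by
    have h1 : K * h ^ 2 ≤ κ / 2 := by
      have : K * h ^ 2 = ℓ ^ 2 / K := by rw [hh]; field_simp
      rw [this, div_le_iff₀ hK0]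
      rw [div_lt_iff₀ (by positivity)] at hK2
      linarith
    nlinarith
  set C := Real.log 2 + Real.log 4 + 5 with hC
  have hC0 : 0 < C := by positivity
  have hlog := Real.tendsto_log_atTop.eventually_ge_atTop (K * C / (κ / 2))
  filter_upwards [hlog, eventually_ge_atTop 2] with y hy hy2
  have hly : 0 < Real.log y := Real.log_pos (by linarith)
  have hy0 : 0 < y := by linarith
  have key : ∀ i : ℕ, ∑ q ∈ primesIoc y (y ^ Real.exp (i * h)), (q : ℝ)⁻¹ ≤
      i * (Real.exp h - 1 + C / Real.log y) := by
    intro i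
    induction i with
    | zero =>
      have : primesIoc y (y ^ Real.exp ((0 : ℕ) * h)) = ∅ := by
        ext q
        simp [mem_primesIoc]
      rw [this]; simp
    | succ i ih =>
      refine (sum_inv_primesIoc_add (v := y ^ Real.exp (i * h))).trans ?_
      have he1 : 1 ≤ Real.exp (i * h) := Real.one_le_exp (by positivity)
      have hu2 : y ≤ y ^ Real.exp (i * h) := by
        conv_lhs => rw [← Real.rpow_one y]
        exact Real.rpow_le_rpow_of_exponent_le (by linarith) he1
      have huv : y ^ Real.exp (i * h) ≤ y ^ Real.exp ((i + 1 : ℕ) * h) := by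
        refine Real.rpow_le_rpow_of_exponent_le (by linarith) (Real.exp_le_exp.mpr ?_)
        push_cast
        nlinarith
      have h1 := sum_inv_primesIoc_le (hy2.trans hu2) huv
      rw [Real.log_rpow hy0, Real.log_rpow hy0] at h1
      have h2 : (Real.exp ((i + 1 : ℕ) * h) * Real.log y - Real.exp (i * h) * Real.log y + C) /
          (Real.exp (i * h) * Real.log y) ≤ Real.exp h - 1 + C / Real.log y := by
        have h3 : Real.exp ((i + 1 : ℕ) * h) = Real.exp (i * h) * Real.exp h := by
          rw [← Real.exp_add]; congr 1; push_cast; ring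
        have h4 : (Real.exp ((i + 1 : ℕ) * h) * Real.log y - Real.exp (i * h) * Real.log y + C) /
            (Real.exp (i * h) * Real.log y) =
              Real.exp h - 1 + C / (Real.exp (i * h) * Real.log y) := by
          rw [h3]; field_simp
        rw [h4]
        have h5 : Real.log y ≤ Real.exp (i * h) * Real.log y := le_mul_of_one_le_left hly.le he1
        gcongr
      push_cast at ih h1 h2 ⊢
      linarith
  have hfin := key K
  rw [hKh, hℓ, Real.exp_log (by linarith)] at hfin
  refine hfin.trans ?_
  have h6 : K * (C / Real.log y) ≤ κ / 2 := by
    rw [← mul_div_assoc, div_le_iff₀ hly]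
    rw [div_le_iff₀ (by positivity)] at hy
    linarith
  linarith

end BeattyNonresidue

namespace BeattyNonresidue

open Finset Filter

/-- The number of elements of `P` dividing `m`. -/
def divCount (P : Finset ℕ) (m : ℕ) : ℕ := (P.filter (· ∣ m)).card

lemma divCount_eq_sum (P : Finset ℕ) (m : ℕ) :
    (divCount P m : ℝ) = ∑ p ∈ P, if p ∣ m then (1 : ℝ) else 0 := by
  rw [divCount, sum_boole]

lemma sum_divCount_mul (P : Finset ℕ) (N : ℕ) (hP : ∀ p ∈ P, 0 < p) {E : Type*} [AddCommGroup E]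
    [Module ℝ E] (g : ℕ → E) :
    ∑ m ∈ Icc 1 N, (divCount P m : ℝ) • g m =
      ∑ p ∈ P, ∑ k ∈ Icc 1 N, if p * k ≤ N then g (p * k) else 0 := by
  simp_rw [divCount_eq_sum, sum_smul, ite_smul, one_smul, zero_smul]
  rw [sum_comm]
  refine sum_congr rfl fun p hp => ?_
  have hp0 := hP p hp
  rw [← sum_filter, ← sum_filter]
  symm
  refine sum_nbij (p * ·) ?_ ?_ ?_ fun _ _ => rfl
  · intro k hk
    simp only [mem_filter, mem_Icc] at hk ⊢
    exact ⟨⟨Nat.mul_pos hp0 hk.1.1, hk.2⟩, dvd_mul_right _ _⟩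
  · intro a _ b _ h
    exact Nat.eq_of_mul_eq_mul_left hp0 h
  · intro m hm
    simp only [coe_filter, mem_Icc, Set.mem_ofPred_eq, Set.mem_image] at hm ⊢
    obtain ⟨⟨h1, h2⟩, k, rfl⟩ := hm
    exact ⟨k, ⟨⟨Nat.pos_of_mul_pos_left h1, (Nat.le_mul_of_pos_left k hp0).trans h2⟩, h2⟩, rfl⟩

lemma sum_divCount_ge (P : Finset ℕ) (N : ℕ) (hP : ∀ p ∈ P, 0 < p) :
    N * ∑ p ∈ P, (p : ℝ)⁻¹ - P.card ≤ ∑ m ∈ Icc 1 N, (divCount P m : ℝ) := by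
  simp_rw [divCount_eq_sum]
  rw [sum_comm, mul_sum, card_eq_sum_ones, Nat.cast_sum, ← sum_sub_distrib]
  refine sum_le_sum fun p hp => ?_
  have hp0 := hP p hp
  rw [sum_boole, card_Icc_filter_dvd, Nat.cast_one, sub_le_iff_le_add, ← div_eq_mul_inv,
    div_le_iff₀ (by exact_mod_cast hp0)]
  have := Nat.lt_mul_of_div_lt (Nat.lt_succ_self (N / p)) hp0
  exact_mod_cast this.le

lemma sum_divCount_sq_le (P : Finset ℕ) (N : ℕ) (hP : ∀ p ∈ P, p.Prime) :
    ∑ m ∈ Icc 1 N, (divCount P m : ℝ) ^ 2 ≤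
      N * ((∑ p ∈ P, (p : ℝ)⁻¹) ^ 2 + ∑ p ∈ P, (p : ℝ)⁻¹) := by
  have h1 : ∀ m, (divCount P m : ℝ) ^ 2 =
      ∑ p ∈ P, ∑ q ∈ P, if p ∣ m ∧ q ∣ m then (1 : ℝ) else 0 := by
    intro m
    rw [divCount_eq_sum, sq, sum_mul_sum]
    refine sum_congr rfl fun p _ => sum_congr rfl fun q _ => ?_
    split_ifs <;> simp_all
  simp_rw [h1]
  rw [sum_comm]
  have h2 : ∀ p ∈ P, ∀ q ∈ P, ∑ m ∈ Icc 1 N, (if p ∣ m ∧ q ∣ m then (1 : ℝ) else 0) ≤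
      N * ((p : ℝ)⁻¹ * (q : ℝ)⁻¹ + if p = q then (p : ℝ)⁻¹ else 0) := by
    intro p hp q hq
    have hle : ∀ d : ℕ, (((Icc 1 N).filter (d ∣ ·)).card : ℝ) ≤ N * (d : ℝ)⁻¹ := by
      intro d
      rw [card_Icc_filter_dvd, ← div_eq_mul_inv]
      exact Nat.cast_div_le
    rw [sum_boole]
    by_cases hpq : p = q
    · subst hpq
      simp only [and_self, if_true]
      refine (hle p).trans ?_
      have : 0 ≤ (N : ℝ) * ((p : ℝ)⁻¹ * (p : ℝ)⁻¹) := by positivity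
      linarith
    · have hcop : Nat.Coprime p q := (Nat.coprime_primes (hP p hp) (hP q hq)).mpr hpq
      simp only [hpq, if_false, add_zero]
      have h3 : (Icc 1 N).filter (fun m => p ∣ m ∧ q ∣ m) = (Icc 1 N).filter (p * q ∣ ·) := by
        refine filter_congr fun m _ => ⟨fun h => hcop.mul_dvd_of_dvd_of_dvd h.1 h.2, fun h =>
          ⟨(dvd_mul_right _ _).trans h, (dvd_mul_left _ _).trans h⟩⟩
      rw [h3]
      refine (hle _).trans (le_of_eq ?_)
      push_cast
      rw [mul_inv]
  calc _ ≤ ∑ p ∈ P, ∑ q ∈ P, N * ((p : ℝ)⁻¹ * (q : ℝ)⁻¹ + if p = q then (p : ℝ)⁻¹ else 0) := by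
        refine sum_le_sum fun p hp => ?_
        rw [sum_comm]
        exact sum_le_sum fun q hq => h2 p hp q hq
    _ = _ := by
        simp_rw [← mul_sum, sum_add_distrib, ← mul_sum, ← sum_mul]
        rw [sq]
        congr 2
        refine sum_congr rfl fun p hp => ?_
        simp [hp]

/-- The Turán–Kubilius variance bound for a finite set of primes. -/
lemma sum_divCount_sub_sq_le (P : Finset ℕ) (N : ℕ) (hP : ∀ p ∈ P, p.Prime) :
    ∑ m ∈ Icc 1 N, ((divCount P m : ℝ) - ∑ p ∈ P, (p : ℝ)⁻¹) ^ 2 ≤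
      N * ∑ p ∈ P, (p : ℝ)⁻¹ + 2 * (∑ p ∈ P, (p : ℝ)⁻¹) * P.card := by
  set L := ∑ p ∈ P, (p : ℝ)⁻¹ with hL
  have hL0 : 0 ≤ L := sum_nonneg fun _ _ => by positivity
  have h1 := sum_divCount_ge P N fun p hp => (hP p hp).pos
  have h2 := sum_divCount_sq_le P N hP
  rw [← hL] at h1 h2
  have h3 : ∑ m ∈ Icc 1 N, ((divCount P m : ℝ) - L) ^ 2 =
      ∑ m ∈ Icc 1 N, (divCount P m : ℝ) ^ 2 - 2 * L * ∑ m ∈ Icc 1 N, (divCount P m : ℝ) +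
        N * L ^ 2 := by
    simp_rw [sub_sq]
    rw [sum_add_distrib, sum_sub_distrib, mul_sum, sum_const, Nat.card_Icc, nsmul_eq_mul]
    simp only [Nat.add_sub_cancel]
    congr 2
    exact sum_congr rfl fun _ _ => by ring
  rw [h3]
  nlinarith [mul_le_mul_of_nonneg_left h1 hL0]

lemma norm_sum_pow_le (w : ℂ) (hw : ‖w‖ = 1) (hw1 : w ≠ 1) (M : ℕ) :
    ‖∑ k ∈ Icc 1 M, w ^ k‖ ≤ 2 / ‖w - 1‖ := by
  have h1 : ∑ k ∈ Icc 1 M, w ^ k = w * ((w ^ M - 1) / (w - 1)) := by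
    have h2 : Icc 1 M = Ico 1 (M + 1) := rfl
    rw [← geom_sum_eq hw1, mul_sum, h2, sum_Ico_eq_sum_range, Nat.add_sub_cancel]
    exact sum_congr rfl fun k _ => by rw [pow_add, pow_one]
  rw [h1, norm_mul, hw, one_mul, norm_div]
  gcongr
  refine (norm_sub_le _ _).trans ?_
  rw [norm_pow, hw]
  norm_num

lemma sum_norm_sq_sum_le {ι κ : Type*} (s : Finset κ) (P : Finset ι) (c : ι → κ → ℂ) :
    ∑ k ∈ s, ‖∑ p ∈ P, c p k‖ ^ 2 ≤
      ∑ p ∈ P, ∑ q ∈ P, ‖∑ k ∈ s, c p k * starRingEnd ℂ (c q k)‖ := by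
  have h1 : ((∑ k ∈ s, ‖∑ p ∈ P, c p k‖ ^ 2 : ℝ) : ℂ) =
      ∑ p ∈ P, ∑ q ∈ P, ∑ k ∈ s, c p k * starRingEnd ℂ (c q k) := by
    push_cast
    simp_rw [← Complex.mul_conj', map_sum, sum_mul_sum]
    rw [sum_comm]
    exact sum_congr rfl fun p _ => sum_comm
  have h2 : 0 ≤ ∑ k ∈ s, ‖∑ p ∈ P, c p k‖ ^ 2 := by positivity
  rw [← Complex.norm_of_nonneg h2, h1]
  exact (norm_sum_le _ _).trans (sum_le_sum fun p _ => norm_sum_le _ _)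

lemma pow_mul_conj_pow_ne_one (z : ℂ) (hz : ‖z‖ = 1) (hz' : ∀ j : ℕ, 0 < j → z ^ j ≠ 1) {a b : ℕ}
    (hab : a ≠ b) : z ^ a * starRingEnd ℂ (z ^ b) ≠ 1 := by
  have hz0 : z ≠ 0 := by rintro rfl; simp at hz
  intro h
  have h1 : z ^ a = z ^ b := by
    have h2 : starRingEnd ℂ (z ^ b) * z ^ b = 1 := by
      rw [mul_comm, Complex.mul_conj', norm_pow, hz]; simp
    calc z ^ a = z ^ a * (starRingEnd ℂ (z ^ b) * z ^ b) := by rw [h2, mul_one]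
      _ = z ^ b := by rw [← mul_assoc, h, one_mul]
  rcases lt_or_gt_of_ne hab with h3 | h3
  · refine hz' (b - a) (by omega) ?_
    have : z ^ b = z ^ a * z ^ (b - a) := by rw [← pow_add]; congr 1; omega
    rw [this] at h1
    exact (mul_right_eq_self₀.mp h1.symm).resolve_right (pow_ne_zero _ hz0)
  · refine hz' (a - b) (by omega) ?_
    have : z ^ a = z ^ b * z ^ (a - b) := by rw [← pow_add]; congr 1; omega
    rw [this] at h1
    exact (mul_right_eq_self₀.mp h1).resolve_right (pow_ne_zero _ hz0)

/-- The Daboussi–Kátai inequality for a finite set of primes. -/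
lemma norm_sum_mul_pow_sq_le (z : ℂ) (hz : ‖z‖ = 1) (hz' : ∀ j : ℕ, 0 < j → z ^ j ≠ 1)
    (P : Finset ℕ) (hP : ∀ p ∈ P, p.Prime) : ∃ C : ℝ, ∀ N : ℕ, ∀ f : ℕ → ℝ,
      (∀ a b, f (a * b) = f a * f b) → (∀ n, |f n| ≤ 1) →
        ((∑ p ∈ P, (p : ℝ)⁻¹) * ‖∑ m ∈ Icc 1 N, (f m : ℂ) * z ^ m‖) ^ 2 ≤
          4 * N * (N * ∑ p ∈ P, (p : ℝ)⁻¹ + C) := by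
  set L := ∑ p ∈ P, (p : ℝ)⁻¹ with hL
  have hL0 : 0 ≤ L := sum_nonneg fun _ _ => by positivity
  set C₁ := 2 * L * P.card
  set C₂ := ∑ p ∈ P, ∑ q ∈ P, 2 / ‖z ^ p * starRingEnd ℂ (z ^ q) - 1‖ with hC₂
  have hC₁0 : 0 ≤ C₁ := by positivity
  have hC₂0 : 0 ≤ C₂ := by positivity
  refine ⟨C₁ + C₂, fun N f hmul hf => ?_⟩
  have hfn : ∀ n, ‖(f n : ℂ)‖ ≤ 1 := fun n => by rw [Complex.norm_real]; exact hf n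
  set S := ∑ m ∈ Icc 1 N, (f m : ℂ) * z ^ m with hS
  set c : ℕ → ℕ → ℂ := fun p k => if p * k ≤ N then (f p : ℂ) * z ^ (p * k) else 0 with hc
  set D := ∑ m ∈ Icc 1 N, (((divCount P m : ℝ) - L : ℝ) : ℂ) * ((f m : ℂ) * z ^ m) with hD
  set G := ∑ k ∈ Icc 1 N, (f k : ℂ) * ∑ p ∈ P, c p k with hG
  have hsplit : (L : ℂ) * S = G - D := by
    have h1 : ∑ m ∈ Icc 1 N, ((divCount P m : ℝ)) • ((f m : ℂ) * z ^ m) = G := by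
      rw [sum_divCount_mul P N fun p hp => (hP p hp).pos, hG, sum_comm]
      refine sum_congr rfl fun k _ => ?_
      rw [mul_sum]
      refine sum_congr rfl fun p _ => ?_
      simp only [hc]
      split_ifs
      · rw [hmul]; push_cast; ring
      · simp
    rw [← h1, hD, hS, mul_sum, ← sum_sub_distrib]
    refine sum_congr rfl fun m _ => ?_
    rw [Complex.real_smul]
    push_cast
    ring
  have hcs : ∀ g h : ℕ → ℂ, (∀ k, ‖g k‖ ≤ 1) →
      ‖∑ k ∈ Icc 1 N, h k * g k‖ ^ 2 ≤ N * ∑ k ∈ Icc 1 N, ‖h k‖ ^ 2 := by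
    intro g h hg
    have h1 : ‖∑ k ∈ Icc 1 N, h k * g k‖ ≤ ∑ k ∈ Icc 1 N, ‖h k‖ := by
      refine (norm_sum_le _ _).trans (sum_le_sum fun k _ => ?_)
      rw [norm_mul]
      exact mul_le_of_le_one_right (norm_nonneg _) (hg k)
    calc _ ≤ (∑ k ∈ Icc 1 N, ‖h k‖) ^ 2 := by gcongr
      _ ≤ ((Icc 1 N).card : ℝ) * ∑ k ∈ Icc 1 N, ‖h k‖ ^ 2 := sq_sum_le_card_mul_sum_sq
      _ = _ := by simp
  have hDle : ‖D‖ ^ 2 ≤ N * (N * L + C₁) := by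
    refine (hcs _ _ fun k => ?_).trans ?_
    · rw [norm_mul, norm_pow, hz, one_pow, mul_one]; exact hfn k
    · refine mul_le_mul_of_nonneg_left (le_trans (le_of_eq ?_) (sum_divCount_sub_sq_le P N hP))
        (Nat.cast_nonneg N)
      refine sum_congr rfl fun k _ => ?_
      rw [Complex.norm_real, Real.norm_eq_abs, sq_abs]
  have hpair : ∀ p ∈ P, ∀ q ∈ P, ‖∑ k ∈ Icc 1 N, c p k * starRingEnd ℂ (c q k)‖ ≤
      (if p = q then N * (p : ℝ)⁻¹ else 0) + 2 / ‖z ^ p * starRingEnd ℂ (z ^ q) - 1‖ := by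
    intro p hp q hq
    have hp0 := (hP p hp).pos
    have hq0 := (hP q hq).pos
    have h1 : ∑ k ∈ Icc 1 N, c p k * starRingEnd ℂ (c q k) =
        (f p : ℂ) * f q * ∑ k ∈ Icc 1 (min (N / p) (N / q)),
          (z ^ p * starRingEnd ℂ (z ^ q)) ^ k := by
      have h2 : Icc 1 (min (N / p) (N / q)) =
          (Icc 1 N).filter fun k => p * k ≤ N ∧ q * k ≤ N := by
        ext k
        simp only [mem_Icc, mem_filter, le_min_iff, Nat.le_div_iff_mul_le hp0,
          Nat.le_div_iff_mul_le hq0]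
        constructor
        · rintro ⟨h3, h4, h5⟩
          exact ⟨⟨h3, (Nat.le_mul_of_pos_right k hp0).trans h4⟩, by rwa [mul_comm],
            by rwa [mul_comm]⟩
        · rintro ⟨⟨h3, _⟩, h4, h5⟩
          exact ⟨h3, by rwa [mul_comm], by rwa [mul_comm]⟩
      rw [h2, sum_filter, mul_sum]
      refine sum_congr rfl fun k _ => ?_
      simp only [hc]
      by_cases h3 : p * k ≤ N <;> by_cases h4 : q * k ≤ N <;> simp [h3, h4]
      ring
    rw [h1, norm_mul, norm_mul]
    have hff : ‖(f p : ℂ)‖ * ‖(f q : ℂ)‖ ≤ 1 := mul_le_one₀ (hfn p) (norm_nonneg _) (hfn q)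
    refine (mul_le_of_le_one_left (norm_nonneg _) hff).trans ?_
    have hw : ‖z ^ p * starRingEnd ℂ (z ^ q)‖ = 1 := by simp [hz]
    by_cases hpq : p = q
    · subst hpq
      simp only [if_true]
      have h5 : ‖∑ k ∈ Icc 1 (min (N / p) (N / p)), (z ^ p * starRingEnd ℂ (z ^ p)) ^ k‖ ≤
          N * (p : ℝ)⁻¹ := by
        refine (norm_sum_le _ _).trans ?_
        simp_rw [norm_pow, hw, one_pow]
        simp only [sum_const, Nat.card_Icc, min_self, Nat.add_sub_cancel, nsmul_eq_mul, mul_one]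
        rw [← div_eq_mul_inv]
        exact Nat.cast_div_le
      have : 0 ≤ 2 / ‖z ^ p * starRingEnd ℂ (z ^ p) - 1‖ := by positivity
      linarith
    · simp only [hpq, if_false, zero_add]
      exact norm_sum_pow_le _ hw (pow_mul_conj_pow_ne_one z hz hz' hpq) _
  have hGle : ‖G‖ ^ 2 ≤ N * (N * L + C₂) := by
    have h1 : G = ∑ k ∈ Icc 1 N, (∑ p ∈ P, c p k) * (f k : ℂ) :=
      sum_congr rfl fun k _ => mul_comm _ _
    rw [h1]
    refine (hcs _ _ hfn).trans (mul_le_mul_of_nonneg_left ?_ (Nat.cast_nonneg N))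
    refine (sum_norm_sq_sum_le _ _ _).trans ?_
    refine (sum_le_sum fun p hp => sum_le_sum fun q hq => hpair p hp q hq).trans (le_of_eq ?_)
    simp_rw [sum_add_distrib]
    rw [hL, mul_sum]
    congr 1
    refine sum_congr rfl fun p hp => ?_
    simp [hp]
  have h1 : L * ‖S‖ ≤ ‖G‖ + ‖D‖ := by
    have : ‖(L : ℂ) * S‖ = L * ‖S‖ := by rw [norm_mul, Complex.norm_of_nonneg hL0]
    rw [← this, hsplit]
    exact norm_sub_le _ _
  have hN0 : (0 : ℝ) ≤ N := Nat.cast_nonneg N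
  calc (L * ‖S‖) ^ 2 ≤ (‖G‖ + ‖D‖) ^ 2 := by gcongr
    _ ≤ 2 * (‖G‖ ^ 2 + ‖D‖ ^ 2) := add_sq_le
    _ ≤ 2 * (N * (N * L + C₂) + N * (N * L + C₁)) := by gcongr
    _ ≤ _ := by nlinarith [mul_nonneg hN0 hC₁0, mul_nonneg hN0 hC₂0]

lemma exists_primes_sum_inv_ge (B : ℝ) :
    ∃ P : Finset ℕ, (∀ p ∈ P, p.Prime) ∧ B ≤ ∑ p ∈ P, (p : ℝ)⁻¹ := by
  have h1 : ∃ s : Finset ℕ, B ≤ ∑ n ∈ s, Set.indicator {p : ℕ | p.Prime} (fun n => (1 : ℝ) / n) n := by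
    by_contra! hcon
    exact not_summable_one_div_on_primes (summable_of_sum_le (c := B)
      (fun n => Set.indicator_nonneg (fun _ _ => by positivity) n) fun s => (hcon s).le)
  obtain ⟨s, hs⟩ := h1
  refine ⟨s.filter Nat.Prime, fun p hp => (mem_filter.mp hp).2, hs.trans (le_of_eq ?_)⟩
  rw [sum_filter]
  refine sum_congr rfl fun n _ => ?_
  simp [Set.indicator_apply]

/-- Daboussi's theorem, uniformly over real completely multiplicative functions bounded by `1`. -/
theorem daboussi (z : ℂ) (hz : ‖z‖ = 1) (hz' : ∀ j : ℕ, 0 < j → z ^ j ≠ 1) (ε : ℝ) (hε : 0 < ε) :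
    ∃ N₀ : ℕ, ∀ N : ℕ, N₀ ≤ N → ∀ f : ℕ → ℝ, (∀ a b, f (a * b) = f a * f b) →
      (∀ n, |f n| ≤ 1) → ‖∑ m ∈ Icc 1 N, (f m : ℂ) * z ^ m‖ ≤ ε * N := by
  obtain ⟨P, hP, hPL⟩ := exists_primes_sum_inv_ge (8 / ε ^ 2)
  obtain ⟨C, hC⟩ := norm_sum_mul_pow_sq_le z hz hz' P hP
  set L := ∑ p ∈ P, (p : ℝ)⁻¹
  have hL0 : 0 < L := lt_of_lt_of_le (by positivity) hPL
  obtain ⟨N₀, hN₀⟩ := exists_nat_ge (C / L)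
  refine ⟨N₀, fun N hN f hmul hf => ?_⟩
  have h1 := hC N f hmul hf
  set S := ‖∑ m ∈ Icc 1 N, (f m : ℂ) * z ^ m‖
  have hN0 : (0 : ℝ) ≤ N := Nat.cast_nonneg N
  have h2 : C ≤ N * L := by
    rw [← div_le_iff₀ hL0]
    exact hN₀.trans (by exact_mod_cast hN)
  have h3 : 8 ≤ L * ε ^ 2 := by rwa [div_le_iff₀ (by positivity)] at hPL
  refine le_of_mul_le_mul_left (le_of_sq_le_sq ?_ (by positivity)) hL0
  calc (L * S) ^ 2 ≤ 4 * N * (N * L + C) := h1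
    _ ≤ 4 * N * (N * L + N * L) := by gcongr
    _ = 8 * (N ^ 2 * L) := by ring
    _ ≤ L * ε ^ 2 * (N ^ 2 * L) := by gcongr
    _ = (L * (ε * N)) ^ 2 := by ring

end BeattyNonresidue

namespace BeattyNonresidue

open Finset Filter

/-- `φ` has orbit sums along `m ↦ mγ + c` that decorrelate from completely multiplicative
functions, up to the contribution of its mean. -/
def Decorrelates (γ c : ℝ) (φ : C(UnitAddCircle, ℂ)) : Prop :=
  ∀ ε : ℝ, 0 < ε → ∃ N₀ : ℕ, ∀ N : ℕ, N₀ ≤ N → ∀ f : ℕ → ℝ, (∀ a b, f (a * b) = f a * f b) →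
    (∀ n, |f n| ≤ 1) →
      ‖∑ m ∈ Icc 1 N, (f m : ℂ) * (φ ((γ * m + c : ℝ) : UnitAddCircle) -
        ∫ x, φ x ∂AddCircle.haarAddCircle)‖ ≤ ε * N

lemma integrable_of_continuousMap (φ : C(UnitAddCircle, ℂ)) :
    MeasureTheory.Integrable φ AddCircle.haarAddCircle :=
  φ.continuous.integrable_of_hasCompactSupport (HasCompactSupport.of_compactSpace φ)

lemma decorrelates_fourier (γ c : ℝ) (hγ : Irrational γ) (n : ℤ) :
    Decorrelates γ c (fourier n) := by
  intro ε hε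
  rcases eq_or_ne n 0 with rfl | hn
  · refine ⟨0, fun N _ f _ _ => ?_⟩
    simp only [fourier_zero]
    simp
    positivity
  · have hint : ∫ x : UnitAddCircle, fourier n x ∂AddCircle.haarAddCircle = 0 :=
      MeasureTheory.integral_eq_zero_of_add_right_eq_neg (g := ((1 / 2 / n : ℝ) : UnitAddCircle))
        (fourier_add_half_inv_index hn one_pos)
    set z : ℂ := fourier n (γ : UnitAddCircle) with hz
    set u : ℂ := fourier n (c : UnitAddCircle) with hu
    have hnorm : ∀ x : ℝ, ‖(fourier n (x : UnitAddCircle) : ℂ)‖ = 1 := by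
      intro x
      rw [fourier_apply, Circle.norm_coe]
    have hpow : ∀ m : ℕ, (fourier n ((γ * m + c : ℝ) : UnitAddCircle) : ℂ) = u * z ^ m := by
      intro m
      rw [hz, hu, fourier_coe_apply, fourier_coe_apply, fourier_coe_apply, ← Complex.exp_nat_mul,
        ← Complex.exp_add]
      congr 1
      push_cast
      ring
    have hz' : ∀ j : ℕ, 0 < j → z ^ j ≠ 1 := by
      intro j hj h
      rw [hz, fourier_coe_apply, ← Complex.exp_nat_mul, Complex.exp_eq_one_iff] at h
      obtain ⟨k, hk⟩ := h
      have h2 : (j * n * γ : ℂ) = k := by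
        have h3 : (2 * Real.pi * Complex.I : ℂ) ≠ 0 := Complex.two_pi_I_ne_zero
        refine mul_right_cancel₀ h3 ?_
        rw [← hk]
        push_cast
        ring
      have h4 : (j * n * γ : ℝ) = k := by exact_mod_cast h2
      have h5 : ((j * n : ℤ) : ℝ) ≠ 0 := by
        exact_mod_cast mul_ne_zero (by exact_mod_cast hj.ne') hn
      have h6 : Irrational (((j * n : ℤ) : ℝ) * γ) := hγ.intCast_mul (by exact_mod_cast h5)
      refine h6 ⟨k, ?_⟩
      push_cast
      exact h4.symm
    obtain ⟨N₀, hN₀⟩ := daboussi z (hnorm γ) hz' ε hε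
    refine ⟨N₀, fun N hN f hmul hf => ?_⟩
    have h1 : ∑ m ∈ Icc 1 N, (f m : ℂ) * (fourier n ((γ * m + c : ℝ) : UnitAddCircle) -
        ∫ x : UnitAddCircle, fourier n x ∂AddCircle.haarAddCircle) = u * ∑ m ∈ Icc 1 N, (f m : ℂ) * z ^ m := by
      rw [hint, mul_sum]
      refine sum_congr rfl fun m _ => ?_
      rw [hpow]
      ring
    rw [h1, norm_mul, hnorm c, one_mul]
    exact hN₀ N hN f hmul hf

lemma decorrelates_of_mem_span (γ c : ℝ) (hγ : Irrational γ) (φ : C(UnitAddCircle, ℂ))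
    (hφ : φ ∈ Submodule.span ℂ (Set.range (@fourier (1 : ℝ)))) : Decorrelates γ c φ := by
  induction hφ using Submodule.span_induction with
  | mem φ h =>
    obtain ⟨n, rfl⟩ := h
    exact decorrelates_fourier γ c hγ n
  | zero =>
    intro ε hε
    refine ⟨0, fun N _ f _ _ => ?_⟩
    simp
    positivity
  | add φ ψ _ _ hφ hψ =>
    intro ε hε
    obtain ⟨N₁, h₁⟩ := hφ (ε / 2) (half_pos hε)
    obtain ⟨N₂, h₂⟩ := hψ (ε / 2) (half_pos hε)
    refine ⟨max N₁ N₂, fun N hN f hmul hf => ?_⟩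
    have h3 := h₁ N ((le_max_left _ _).trans hN) f hmul hf
    have h4 := h₂ N ((le_max_right _ _).trans hN) f hmul hf
    have h5 : ∫ x, (φ + ψ) x ∂AddCircle.haarAddCircle =
        ∫ x, φ x ∂AddCircle.haarAddCircle + ∫ x, ψ x ∂AddCircle.haarAddCircle :=
      MeasureTheory.integral_add (integrable_of_continuousMap φ) (integrable_of_continuousMap ψ)
    have h6 := (norm_add_le _ _).trans (add_le_add h3 h4)
    rw [← sum_add_distrib] at h6
    rw [h5]
    refine le_trans (le_of_eq ?_) (h6.trans (le_of_eq (by ring)))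
    congr 1
    refine sum_congr rfl fun m _ => ?_
    simp only [ContinuousMap.add_apply]
    ring
  | smul a φ _ hφ =>
    intro ε hε
    obtain ⟨N₀, h₀⟩ := hφ (ε / (‖a‖ + 1)) (by positivity)
    refine ⟨N₀, fun N hN f hmul hf => ?_⟩
    have h1 := h₀ N hN f hmul hf
    have h2 : ∑ m ∈ Icc 1 N, (f m : ℂ) * ((a • φ) ((γ * m + c : ℝ) : UnitAddCircle) -
        ∫ x, (a • φ) x ∂AddCircle.haarAddCircle) =
        a * ∑ m ∈ Icc 1 N, (f m : ℂ) * (φ ((γ * m + c : ℝ) : UnitAddCircle) -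
        ∫ x, φ x ∂AddCircle.haarAddCircle) := by
      have h3 : ∫ x, (a • φ) x ∂AddCircle.haarAddCircle =
          a * ∫ x, φ x ∂AddCircle.haarAddCircle := MeasureTheory.integral_const_mul a _
      rw [h3, mul_sum]
      refine sum_congr rfl fun m _ => ?_
      simp only [ContinuousMap.smul_apply, smul_eq_mul]
      ring
    rw [h2, norm_mul]
    have ha : 0 < ‖a‖ + 1 := by positivity
    calc _ ≤ (‖a‖ + 1) * (ε / (‖a‖ + 1) * N) := by gcongr; linarith
      _ = ε * N := by field_simp

lemma decorrelates (γ c : ℝ) (hγ : Irrational γ) (φ : C(UnitAddCircle, ℂ)) :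
    Decorrelates γ c φ := by
  intro ε hε
  have hmem : φ ∈ (Submodule.span ℂ (Set.range (@fourier (1 : ℝ)))).topologicalClosure := by
    rw [span_fourier_closure_eq_top]
    trivial
  rw [← SetLike.mem_coe, Submodule.topologicalClosure_coe, Metric.mem_closure_iff] at hmem
  obtain ⟨ψ, hψ, hdist⟩ := hmem (ε / 3) (by positivity)
  rw [dist_eq_norm] at hdist
  obtain ⟨N₀, h₀⟩ := decorrelates_of_mem_span γ c hγ ψ hψ (ε / 3) (by positivity)
  refine ⟨N₀, fun N hN f hmul hf => ?_⟩
  have h1 := h₀ N hN f hmul hf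
  have hpt : ∀ x, ‖φ x - ψ x‖ ≤ ε / 3 := fun x =>
    ((φ - ψ).norm_coe_le_norm x).trans hdist.le
  have hint : ‖(∫ x, φ x ∂AddCircle.haarAddCircle) - ∫ x, ψ x ∂AddCircle.haarAddCircle‖ ≤ ε / 3 := by
    rw [← MeasureTheory.integral_sub (integrable_of_continuousMap φ) (integrable_of_continuousMap ψ)]
    have := MeasureTheory.norm_integral_le_of_norm_le_const (μ := AddCircle.haarAddCircle)
      (Eventually.of_forall hpt)
    simpa using this
  have h2 : ‖∑ m ∈ Icc 1 N, (f m : ℂ) * ((φ ((γ * m + c : ℝ) : UnitAddCircle) -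
      ψ ((γ * m + c : ℝ) : UnitAddCircle)) -
      ((∫ x, φ x ∂AddCircle.haarAddCircle) - ∫ x, ψ x ∂AddCircle.haarAddCircle))‖ ≤
      2 * ε / 3 * N := by
    refine (norm_sum_le _ _).trans ?_
    have : ∀ m ∈ Icc 1 N, ‖(f m : ℂ) * ((φ ((γ * m + c : ℝ) : UnitAddCircle) -
        ψ ((γ * m + c : ℝ) : UnitAddCircle)) -
        ((∫ x, φ x ∂AddCircle.haarAddCircle) - ∫ x, ψ x ∂AddCircle.haarAddCircle))‖ ≤
        2 * ε / 3 := by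
      intro m _
      rw [norm_mul, Complex.norm_real]
      refine (mul_le_of_le_one_left (norm_nonneg _) (hf m)).trans ?_
      refine (norm_sub_le _ _).trans ?_
      linarith [hpt ((γ * m + c : ℝ) : UnitAddCircle)]
    refine (sum_le_sum this).trans (le_of_eq ?_)
    rw [sum_const, Nat.card_Icc, nsmul_eq_mul, Nat.add_sub_cancel, mul_comm]
  have h3 := (norm_add_le _ _).trans (add_le_add h1 h2)
  rw [← sum_add_distrib] at h3
  refine le_trans (le_of_eq ?_) (h3.trans (le_of_eq (by ring)))
  congr 1
  refine sum_congr rfl fun m _ => ?_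
  ring

/-- A bump function on the circle supported on the arc `(0, γ)`. -/
noncomputable def arcBump (γ : ℝ) : C(UnitAddCircle, ℝ) where
  toFun x := max 0 (γ / 2 - ‖x - ((γ / 2 : ℝ) : UnitAddCircle)‖)
  continuous_toFun := by fun_prop

lemma fract_mem_of_arcBump_ne_zero {γ : ℝ} (hγ1 : γ < 1) {y : ℝ}
    (h : arcBump γ (y : UnitAddCircle) ≠ 0) : 0 < Int.fract y ∧ Int.fract y < γ := by
  have h1 : ‖(y : UnitAddCircle) - ((γ / 2 : ℝ) : UnitAddCircle)‖ < γ / 2 := by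
    by_contra! hcon
    exact h (max_eq_left (by linarith))
  rw [← AddCircle.coe_sub, UnitAddCircle.norm_eq, abs_lt] at h1
  set n := round (y - γ / 2)
  have h2 : Int.fract y = y - n := by
    rw [Int.fract_eq_iff]
    exact ⟨by linarith, by linarith, n, by ring⟩
  rw [h2]
  constructor <;> linarith

lemma arcBump_nonneg (γ : ℝ) (x : UnitAddCircle) : 0 ≤ arcBump γ x := le_max_left _ _

lemma arcBump_le (γ : ℝ) (hγ : 0 < γ) (x : UnitAddCircle) : arcBump γ x ≤ γ := by
  refine max_le hγ.le ?_
  have := norm_nonneg (x - ((γ / 2 : ℝ) : UnitAddCircle))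
  linarith

lemma integral_arcBump_pos (γ : ℝ) (hγ : 0 < γ) :
    0 < ∫ x, arcBump γ x ∂AddCircle.haarAddCircle := by
  refine (arcBump γ).continuous.integral_pos_of_hasCompactSupport_nonneg_nonzero
    (HasCompactSupport.of_compactSpace _) (arcBump_nonneg γ) (x := ((γ / 2 : ℝ) : UnitAddCircle)) ?_
  have : arcBump γ ((γ / 2 : ℝ) : UnitAddCircle) = γ / 2 := by
    simp only [arcBump, ContinuousMap.coe_mk, sub_self, norm_zero, sub_zero]
    exact max_eq_right (by positivity)
  rw [this]
  positivity

/-- If a completely multiplicative function equals `e = ±1` along the `m` for which `mγ + c` lies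
in the arc `(0, γ)`, then its mean is close to `e`. -/
theorem abs_sum_sub_le_of_eq_on_arc (γ c : ℝ) (hγ : Irrational γ) (hγ0 : 0 < γ) (hγ1 : γ < 1)
    (m₀ : ℕ) (η : ℝ) (hη : 0 < η) :
    ∃ N₀ : ℕ, ∀ N : ℕ, N₀ ≤ N → ∀ f : ℕ → ℝ, (∀ a b, f (a * b) = f a * f b) →
      (∀ n, |f n| ≤ 1) → ∀ e : ℝ, |e| ≤ 1 → (∀ m, m₀ ≤ m → m ≤ N →
        0 < Int.fract (γ * m + c) → Int.fract (γ * m + c) < γ → f m = e) →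
          |∑ m ∈ Icc 1 N, f m - e * N| ≤ η * N := by
  set φ : C(UnitAddCircle, ℂ) := ⟨fun x => (arcBump γ x : ℂ), by fun_prop⟩ with hφ
  set a : ℝ := ∫ x, arcBump γ x ∂AddCircle.haarAddCircle with ha
  have ha0 : 0 < a := integral_arcBump_pos γ hγ0
  have hint : ∫ x, φ x ∂AddCircle.haarAddCircle = (a : ℂ) := integral_ofReal
  obtain ⟨N₁, h₁⟩ := decorrelates γ c hγ φ (η * a / 4) (by positivity)
  obtain ⟨N₂, h₂⟩ := exists_nat_ge (2 * γ * m₀ / (η * a / 2))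
  refine ⟨max N₁ N₂, fun N hN f hmul hf e he hfe => ?_⟩
  set b : ℕ → ℝ := fun m => arcBump γ ((γ * m + c : ℝ) : UnitAddCircle) with hb
  have key : ∀ g : ℕ → ℝ, (∀ a b, g (a * b) = g a * g b) → (∀ n, |g n| ≤ 1) →
      |∑ m ∈ Icc 1 N, g m * (b m - a)| ≤ η * a / 4 * N := by
    intro g hg hg1
    have := h₁ N ((le_max_left _ _).trans hN) g hg hg1
    rw [hint] at this
    rw [← Real.norm_eq_abs, ← Complex.norm_real]
    push_cast
    exact this
  have k1 := key f hmul hf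
  have k2 := key (fun _ => 1) (by simp) (by simp)
  have k3 : |∑ m ∈ Icc 1 N, (f m - e) * b m| ≤ 2 * γ * m₀ := by
    have hz : ∀ m ∈ Icc 1 N, |(f m - e) * b m| ≤ if m < m₀ then 2 * γ else 0 := by
      intro m hm
      split_ifs with hm0
      · rw [abs_mul]
        have h3 : |f m - e| ≤ 2 := (abs_sub _ _).trans (by linarith [hf m])
        have h4 : |b m| ≤ γ := by
          rw [abs_of_nonneg (arcBump_nonneg _ _)]; exact arcBump_le γ hγ0 _
        gcongr
      · by_cases hbm : b m = 0
        · simp [hbm]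
        · obtain ⟨h3, h4⟩ := fract_mem_of_arcBump_ne_zero hγ1 hbm
          rw [hfe m (by omega) (mem_Icc.mp hm).2 h3 h4]
          simp
    refine (abs_sum_le_sum_abs _ _).trans ((sum_le_sum hz).trans ?_)
    rw [← sum_filter, sum_const, nsmul_eq_mul, mul_comm]
    have h5 : ((Icc 1 N).filter (· < m₀)).card ≤ m₀ := by
      calc _ ≤ (range m₀).card := card_le_card fun m hm => by
            rw [mem_range]; exact (mem_filter.mp hm).2
        _ = m₀ := card_range m₀
    have h6 : (((Icc 1 N).filter (· < m₀)).card : ℝ) ≤ m₀ := by exact_mod_cast h5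
    gcongr
  have hm₀ : 2 * γ * m₀ ≤ η * a / 2 * N := by
    have h3 : (N₂ : ℝ) ≤ N := by exact_mod_cast (le_max_right _ _).trans hN
    have h4 := h₂.trans h3
    rw [div_le_iff₀ (by positivity)] at h4
    linarith
  have hid : a * (∑ m ∈ Icc 1 N, f m - e * N) = ∑ m ∈ Icc 1 N, (f m - e) * b m -
      ∑ m ∈ Icc 1 N, f m * (b m - a) + e * ∑ m ∈ Icc 1 N, 1 * (b m - a) := by
    have h3 : (N : ℝ) = ∑ m ∈ Icc 1 N, (1 : ℝ) := by simp
    rw [h3]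
    simp only [mul_sum, ← sum_sub_distrib, ← sum_add_distrib]
    refine sum_congr rfl fun m _ => by ring
  have h7 : a * |∑ m ∈ Icc 1 N, f m - e * N| ≤ a * (η * N) := by
    rw [← abs_of_pos ha0, ← abs_mul, abs_of_pos ha0, hid]
    refine (abs_add_le _ _).trans ?_
    have h8 := abs_sub (∑ m ∈ Icc 1 N, (f m - e) * b m) (∑ m ∈ Icc 1 N, f m * (b m - a))
    have h9 : |e * ∑ m ∈ Icc 1 N, 1 * (b m - a)| ≤ η * a / 4 * N := by
      rw [abs_mul]
      exact (mul_le_of_le_one_left (abs_nonneg _) he).trans k2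
    linarith
  exact le_of_mul_le_mul_left h7 ha0

end BeattyNonresidue

namespace BeattyNonresidue

open Finset Filter

lemma sum_divCount_le (P : Finset ℕ) (N : ℕ) :
    ∑ m ∈ Icc 1 N, (divCount P m : ℝ) ≤ N * ∑ p ∈ P, (p : ℝ)⁻¹ := by
  simp_rw [divCount_eq_sum]
  rw [sum_comm, mul_sum]
  refine sum_le_sum fun p _ => ?_
  rw [sum_boole, card_Icc_filter_dvd, ← div_eq_mul_inv]
  exact Nat.cast_div_le

/-- If the means of a completely multiplicative `f` over all long enough intervals `[1, t]` are
close to `e = ±1`, then the primes at which `f = -1` have small reciprocal sum. -/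
lemma sum_inv_le_of_mean_close (f : ℕ → ℝ) (hmul : ∀ a b, f (a * b) = f a * f b)
    (hf : ∀ n, |f n| ≤ 1) (e : ℝ) (he : e ^ 2 = 1) (η : ℝ) (hη0 : 0 ≤ η) (hη : η ≤ 1 / 16)
    (Y₀ Y : ℕ) (hY₀ : 0 < Y₀)
    (hmean : ∀ t, Y₀ ≤ t → t ≤ Y → |∑ m ∈ Icc 1 t, f m - e * t| ≤ η * t)
    (Q : Finset ℕ) (hQ : ∀ q ∈ Q, q.Prime ∧ f q = -1 ∧ q * Y₀ ≤ Y) :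
    ∑ q ∈ Q, (q : ℝ)⁻¹ ≤ 16 * η := by
  rcases Q.eq_empty_or_nonempty with rfl | ⟨q₀, hq₀⟩
  · simp; positivity
  have hYY : Y₀ ≤ Y := (Nat.le_mul_of_pos_left _ (hQ q₀ hq₀).1.pos).trans (hQ q₀ hq₀).2.2
  have hY0 : (0 : ℝ) < Y := by exact_mod_cast hY₀.trans_le hYY
  set S := ∑ q ∈ Q, (q : ℝ)⁻¹ with hS
  have hS0 : 0 < S := sum_pos (fun q hq => by have := (hQ q hq).1.pos; positivity) ⟨q₀, hq₀⟩
  have hmean' : ∀ t, Y₀ ≤ t → t ≤ Y → (1 - η) * t ≤ e * ∑ m ∈ Icc 1 t, f m := by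
    intro t h1 h2
    have h3 := hmean t h1 h2
    have he' : |e| = 1 := by
      rw [← sq_abs] at he
      nlinarith [abs_nonneg e]
    have h4 : |e * ∑ m ∈ Icc 1 t, f m - t| ≤ η * t := by
      have : e * ∑ m ∈ Icc 1 t, f m - t = e * (∑ m ∈ Icc 1 t, f m - e * t) := by
        linear_combination (t : ℝ) * he
      rw [this, abs_mul, he', one_mul]
      exact h3
    have := (abs_le.mp h4).1
    linarith
  have hω : ∀ g : ℕ → ℝ, ∑ m ∈ Icc 1 Y, (divCount Q m : ℝ) * g m =
      ∑ q ∈ Q, ∑ k ∈ Icc 1 (Y / q), g (q * k) := by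
    intro g
    have := sum_divCount_mul Q Y (fun q hq => (hQ q hq).1.pos) g
    simp only [smul_eq_mul] at this
    rw [this]
    refine sum_congr rfl fun q hq => ?_
    have hq0 := (hQ q hq).1.pos
    rw [← sum_filter]
    refine sum_congr ?_ fun _ _ => rfl
    ext k
    simp only [mem_filter, mem_Icc, Nat.le_div_iff_mul_le hq0]
    constructor
    · rintro ⟨⟨h1, _⟩, h2⟩
      exact ⟨h1, by rwa [mul_comm]⟩
    · rintro ⟨h1, h2⟩
      rw [mul_comm] at h2
      exact ⟨⟨h1, (Nat.le_mul_of_pos_left k hq0).trans h2⟩, h2⟩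
  have hlow : Y * S / 2 ≤ ∑ m ∈ Icc 1 Y, (divCount Q m : ℝ) * (1 - e * f m) := by
    rw [hω, hS, mul_sum, sum_div]
    refine sum_le_sum fun q hq => ?_
    obtain ⟨hqp, hfq, hqY⟩ := hQ q hq
    have hq0 : (0 : ℝ) < q := by exact_mod_cast hqp.pos
    have h1 : Y₀ ≤ Y / q := (Nat.le_div_iff_mul_le hqp.pos).mpr (by rwa [mul_comm])
    have h2 := hmean' (Y / q) h1 (Nat.div_le_self _ _)
    have h3 : ∑ k ∈ Icc 1 (Y / q), (1 - e * f (q * k)) =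
        ((Y / q : ℕ) : ℝ) + e * ∑ k ∈ Icc 1 (Y / q), f k := by
      rw [sum_sub_distrib, mul_sum]
      simp [hmul, hfq]
    have h4 : (Y : ℝ) * (q : ℝ)⁻¹ ≤ 2 * ((Y / q : ℕ) : ℝ) := by
      rw [← div_eq_mul_inv, div_le_iff₀ hq0]
      have h5 := Nat.lt_mul_of_div_lt (Nat.lt_succ_self (Y / q)) hqp.pos
      have h6 : (Y : ℝ) < (((Y / q : ℕ) : ℝ) + 1) * q := by exact_mod_cast h5
      have h7 : (1 : ℝ) ≤ ((Y / q : ℕ) : ℝ) := by exact_mod_cast hY₀.trans_le h1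
      nlinarith
    rw [h3]
    have h8 : 0 ≤ ((Y / q : ℕ) : ℝ) := Nat.cast_nonneg _
    nlinarith
  have hcs : (∑ m ∈ Icc 1 Y, (divCount Q m : ℝ) * (1 - e * f m)) ^ 2 ≤
      (Y * (S ^ 2 + S)) * (2 * η * Y) := by
    refine (sum_mul_sq_le_sq_mul_sq _ _ _).trans ?_
    have h1 := sum_divCount_sq_le Q Y fun q hq => (hQ q hq).1
    have h2 : ∑ m ∈ Icc 1 Y, (1 - e * f m) ^ 2 ≤ 2 * η * Y := by
      have h3 : ∀ m ∈ Icc 1 Y, (1 - e * f m) ^ 2 ≤ 2 * (1 - e * f m) := by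
        intro m _
        have h4 : (e * f m) ^ 2 ≤ 1 := by
          rw [mul_pow, he, one_mul, ← sq_abs]
          exact pow_le_one₀ (abs_nonneg _) (hf m)
        nlinarith
      refine (sum_le_sum h3).trans ?_
      rw [← mul_sum, sum_sub_distrib, ← mul_sum]
      have := hmean' Y hYY le_rfl
      simp only [sum_const, Nat.card_Icc, Nat.add_sub_cancel, nsmul_eq_mul, mul_one]
      linarith
    exact mul_le_mul h1 h2 (sum_nonneg fun _ _ => sq_nonneg _) (by positivity)
  have h1 : (Y * S / 2) ^ 2 ≤ (Y * (S ^ 2 + S)) * (2 * η * Y) :=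
    (pow_le_pow_left₀ (by positivity) hlow 2).trans hcs
  have h2 : (Y : ℝ) ^ 2 * S * S ≤ (Y : ℝ) ^ 2 * S * (8 * η * (S + 1)) := by linarith
  have h3 := le_of_mul_le_mul_left h2 (by positivity)
  nlinarith

lemma exists_prime_dvd_eq_neg_one (f : ℕ → ℝ) (hmul : ∀ a b, f (a * b) = f a * f b) (N : ℕ)
    (hf : ∀ n, 0 < n → n ≤ N → f n = 1 ∨ f n = -1) (n : ℕ) (hn0 : 0 < n) (hn : n ≤ N)
    (hfn : f n = -1) : ∃ q, q.Prime ∧ q ∣ n ∧ f q = -1 := by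
  by_contra! hcon
  have key : ∀ d : ℕ, d ∣ n → f d = 1 := by
    intro d
    induction d using induction_on_primes with
    | zero => intro h; have := Nat.eq_zero_of_zero_dvd h; omega
    | one =>
      intro _
      have h1 := hmul 1 1
      rcases hf 1 one_pos (by omega) with h | h
      · exact h
      · rw [mul_one, h] at h1; norm_num at h1
    | prime_mul q a hq ih =>
      intro h
      have hqn : q ∣ n := (dvd_mul_right q a).trans h
      rw [hmul, ih ((dvd_mul_left a q).trans h), mul_one]
      exact (hf q hq.pos ((Nat.le_of_dvd hn0 hqn).trans hn)).resolve_right (hcon q hq hqn)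
  rw [key n dvd_rfl] at hfn
  norm_num at hfn

lemma sum_ge_of_nonresidue_primes (f : ℕ → ℝ) (hmul : ∀ a b, f (a * b) = f a * f b) (N : ℕ)
    (hf : ∀ n, 0 < n → n ≤ N → f n = 1 ∨ f n = -1) (Q : Finset ℕ)
    (hQ : ∀ q, q.Prime → q ≤ N → f q = -1 → q ∈ Q) :
    N * (1 - 2 * ∑ q ∈ Q, (q : ℝ)⁻¹) ≤ ∑ n ∈ Icc 1 N, f n := by
  have h1 : ∑ n ∈ Icc 1 N, (1 - f n) ≤ ∑ n ∈ Icc 1 N, 2 * (divCount Q n : ℝ) := by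
    refine sum_le_sum fun n hn => ?_
    rw [mem_Icc] at hn
    rcases hf n hn.1 hn.2 with h | h
    · rw [h]; simp
    · obtain ⟨q, hq, hqn, hfq⟩ := exists_prime_dvd_eq_neg_one f hmul N hf n hn.1 hn.2 h
      have h2 : 1 ≤ divCount Q n := card_pos.mpr
        ⟨q, mem_filter.mpr ⟨hQ q hq ((Nat.le_of_dvd hn.1 hqn).trans hn.2) hfq, hqn⟩⟩
      have h3 : (1 : ℝ) ≤ divCount Q n := by exact_mod_cast h2
      rw [h]
      linarith
  rw [← mul_sum, sum_sub_distrib] at h1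
  have h2 := sum_divCount_le Q N
  simp only [sum_const, Nat.card_Icc, Nat.add_sub_cancel, nsmul_eq_mul, mul_one] at h1
  linarith

lemma qchar_natCast_eq_one_or {p : ℕ} [hp : Fact p.Prime] {n : ℕ} (hn0 : 0 < n) (hn : n < p) :
    qchar p (n : ZMod p) = 1 ∨ qchar p (n : ZMod p) = -1 := by
  refine qchar_eq_one_or fun h => ?_
  rw [ZMod.natCast_eq_zero_iff] at h
  have := Nat.le_of_dvd hn0 h
  omega

lemma one_le_sqrt_exp_one : 5 / 4 ≤ √(Real.exp 1) := by
  refine Real.le_sqrt_of_sq_le ?_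
  have := Real.exp_one_gt_d9
  norm_num
  linarith

/-- Along the `m` with `mγ + c` in the arc `(0, γ)`, the quadratic character modulo a large prime
is not constant up to `p ^ (1 / (4√e) + ε)`. -/
theorem eventually_exists_qchar_ne (γ c : ℝ) (hγ : Irrational γ) (hγ0 : 0 < γ) (hγ1 : γ < 1)
    (m₀ : ℕ) (ε : ℝ) (hε : 0 < ε) (hε1 : ε ≤ 1 / 10) (c₀ : ℝ) (hc₀ : 0 < c₀) :
    ∀ᶠ p : ℕ in atTop, ∀ _ : Fact p.Prime, ∀ e : ℝ, e ^ 2 = 1 → ∃ m : ℕ, m₀ ≤ m ∧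
      (m : ℝ) ≤ c₀ * (p : ℝ) ^ (1 / (4 * √(Real.exp 1)) + ε) ∧ 0 < Int.fract (γ * m + c) ∧
        Int.fract (γ * m + c) < γ ∧ qchar p (m : ZMod p) ≠ e := by
  set s := √(Real.exp 1) with hs
  have hs1 : 5 / 4 ≤ s := one_le_sqrt_exp_one
  set θ : ℝ := 1 / (4 * s) with hθ
  have hθ0 : 0 < θ := by positivity
  have hθs : s * θ = 1 / 4 := by rw [hθ]; field_simp
  have hθ1 : θ ≤ 1 / 5 := by nlinarith
  set R : ℝ := (1 / 4 + ε / 3) / (θ + ε / 2) with hR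
  have hθε : 0 < θ + ε / 2 := by positivity
  have hR1 : 1 < R := by rw [hR, one_lt_div hθε]; linarith
  have hRs : R < s := by rw [hR, div_lt_iff₀ hθε]; nlinarith
  have hR0 : 0 < R := by linarith
  have hlogR : Real.log R < 1 / 2 := by
    have h1 := Real.log_lt_log hR0 hRs
    rwa [hs, Real.log_sqrt (Real.exp_pos 1).le, Real.log_exp] at h1
  have hlogR0 := Real.log_pos hR1
  set κ := 1 / 2 - Real.log R with hκ
  have hκ0 : 0 < κ := by linarith
  obtain ⟨Y₁, hY₁⟩ := abs_sum_sub_le_of_eq_on_arc γ c hγ hγ0 hγ1 m₀ (κ / 64) (by positivity)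
  set Y₀ := Y₁ + 1 with hY₀
  have hY₀pos : (0 : ℝ) < Y₀ := by positivity
  have hcast := tendsto_natCast_atTop_atTop (R := ℝ)
  have e1 := burgess (ε / 4) (κ / 6) (by positivity) (by linarith) (by positivity) (by linarith)
  have e2 := hcast.eventually ((tendsto_rpow_atTop hθε).eventually
    (eventually_sum_inv_primes_le R (κ / 4) hR1 (by positivity)))
  have e3 := hcast.eventually ((tendsto_rpow_atTop (show 0 < ε / 2 by positivity)).eventually_ge_atTop
    (Y₀ / c₀))
  have e4 := hcast.eventually ((tendsto_rpow_atTop (show 0 < ε / 12 by positivity)).eventually_ge_atTop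
    2)
  filter_upwards [e1, e2, e3, e4, eventually_gt_atTop 1] with p h1 h2 h3 h4 h5 hp e he
  by_contra! hcon
  set P : ℝ := (p : ℝ) with hP
  have hP1 : 1 < P := by rw [hP]; exact_mod_cast h5
  have hP0 : 0 < P := by linarith
  set f : ℕ → ℝ := fun n => qchar p (n : ZMod p) with hf
  have hmul : ∀ a b, f (a * b) = f a * f b := by
    intro a b
    simp only [hf]
    rw [Nat.cast_mul, qchar_mul]
  have hf1 : ∀ n, |f n| ≤ 1 := fun n => abs_qchar_le _
  set Y := ⌊c₀ * P ^ (θ + ε)⌋₊ with hY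
  have hmean : ∀ t, Y₀ ≤ t → t ≤ Y → |∑ m ∈ Icc 1 t, f m - e * t| ≤ κ / 64 * t := by
    intro t ht1 ht2
    refine hY₁ t (by omega) f hmul hf1 e ?_ ?_
    · rw [← sq_le_one_iff_abs_le_one, he]
    · intro m hm1 hm2 hm3 hm4
      refine hcon m hm1 ?_ hm3 hm4
      exact (Nat.le_floor_iff (by positivity)).mp (hm2.trans ht2)
  set y := P ^ (θ + ε / 2) with hy
  set N := ⌈P ^ (1 / 4 + ε / 4)⌉₊ with hN
  have hN1 : P ^ (1 / 4 + ε / 4) ≤ N := Nat.le_ceil _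
  have hN1' : 1 ≤ P ^ (1 / 4 + ε / 4) := Real.one_le_rpow hP1.le (by positivity)
  have hN2 : (N : ℝ) ≤ 2 * P ^ (1 / 4 + ε / 4) := by
    have := Nat.ceil_lt_add_one (by positivity : 0 ≤ P ^ (1 / 4 + ε / 4))
    linarith
  have hN0 : (0 : ℝ) < N := by linarith
  have hN3 : (N : ℝ) ≤ P ^ (1 / 4 + ε / 3) := by
    calc (N : ℝ) ≤ 2 * P ^ (1 / 4 + ε / 4) := hN2
      _ ≤ P ^ (ε / 12) * P ^ (1 / 4 + ε / 4) := by gcongr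
      _ = _ := by rw [← Real.rpow_add hP0]; ring_nf
  have hNy : (N : ℝ) ≤ y ^ R := by
    refine hN3.trans (le_of_eq ?_)
    rw [hy, ← Real.rpow_mul hP0.le, hR, mul_div_cancel₀ _ hθε.ne']
  have hNp : N < p := by
    have : (N : ℝ) < P := by
      refine hN3.trans_lt ?_
      conv_rhs => rw [← Real.rpow_one P]
      exact Real.rpow_lt_rpow_of_exponent_lt hP1 (by linarith)
    rw [hP] at this
    exact_mod_cast this
  set Q₁ := (Icc 1 Y).filter fun q => q.Prime ∧ f q = -1 ∧ q * Y₀ ≤ Y with hQ₁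
  have hS := sum_inv_le_of_mean_close f hmul hf1 e he (κ / 64) (by positivity) (by linarith) Y₀ Y
    (by omega) hmean Q₁ fun q hq => (mem_filter.mp hq).2
  have hlow := sum_ge_of_nonresidue_primes f hmul N
    (fun n hn0 hn => qchar_natCast_eq_one_or hn0 (hn.trans_lt hNp)) (Q₁ ∪ primesIoc y (y ^ R)) (by
      intro q hq hqN hfq
      rw [mem_union]
      by_cases hqY : q * Y₀ ≤ Y
      · refine Or.inl (mem_filter.mpr ⟨mem_Icc.mpr ⟨hq.pos, ?_⟩, hq, hfq, hqY⟩)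
        exact (Nat.le_mul_of_pos_right q (by omega)).trans hqY
      · refine Or.inr (mem_primesIoc.mpr ⟨hq, ?_, le_trans (by exact_mod_cast hqN) hNy⟩)
        have h6 : c₀ * P ^ (θ + ε) < (q : ℝ) * Y₀ := by
          have := (Nat.floor_lt (by positivity : 0 ≤ c₀ * P ^ (θ + ε))).mp (not_le.mp hqY)
          exact_mod_cast this
        have h7 : P ^ (θ + ε) = y * P ^ (ε / 2) := by
          rw [hy, ← Real.rpow_add hP0]; ring_nf
        have h8 : (Y₀ : ℝ) ≤ c₀ * P ^ (ε / 2) := by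
          rw [div_le_iff₀ hc₀] at h3
          linarith
        have hy0 : 0 < y := by positivity
        have h9 := mul_le_mul_of_nonneg_left h8 hy0.le
        rw [h7] at h6
        refine lt_of_mul_lt_mul_right ?_ hY₀pos.le
        linarith)
  have hunion : ∑ q ∈ Q₁ ∪ primesIoc y (y ^ R), (q : ℝ)⁻¹ ≤
      ∑ q ∈ Q₁, (q : ℝ)⁻¹ + ∑ q ∈ primesIoc y (y ^ R), (q : ℝ)⁻¹ := by
    rw [← sum_union_inter]
    have : 0 ≤ ∑ q ∈ Q₁ ∩ primesIoc y (y ^ R), (q : ℝ)⁻¹ := sum_nonneg fun _ _ => by positivity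
    linarith
  have hup := h1 hp N hN1 hN2
  have hκN : 0 < κ * N := by positivity
  have hfin : κ * N ≤ N * (1 - 2 * ∑ q ∈ Q₁ ∪ primesIoc y (y ^ R), (q : ℝ)⁻¹) := by
    rw [mul_comm]
    refine mul_le_mul_of_nonneg_left ?_ hN0.le
    linarith
  have : ∑ n ∈ Icc 1 N, f n = ∑ n ∈ Icc 1 N, qchar p (n : ZMod p) := rfl
  linarith

end BeattyNonresidue

namespace BeattyNonresidue

open Finset Filter

/-- For `|α| > 1` every integer `m` (up to a global sign) for which `m / |α| + c` lies in the arc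
`(0, 1 / |α|)` modulo one is a term of the Beatty sequence, at the index `⌊m / |α| + c⌋`. -/
lemma exists_floor_eq_of_fract (α β : ℝ) (hα : α ≠ 0) :
    ∃ c : ℝ, ∃ σ : ℤ, (σ = 1 ∨ σ = -1) ∧ ∀ m : ℕ, 0 < Int.fract (|α|⁻¹ * m + c) →
      Int.fract (|α|⁻¹ * m + c) < |α|⁻¹ → ⌊α * ⌊|α|⁻¹ * m + c⌋ + β⌋ = σ * m := by
  have ha : 0 < |α| := abs_pos.mpr hα
  have key : ∀ (c : ℝ) (m : ℕ), 0 < Int.fract (|α|⁻¹ * m + c) →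
      Int.fract (|α|⁻¹ * m + c) < |α|⁻¹ →
        |α| * ⌊|α|⁻¹ * m + c⌋ < m + |α| * c ∧ m + |α| * c - 1 < |α| * ⌊|α|⁻¹ * m + c⌋ := by
    intro c m h1 h2
    have h3 := Int.floor_add_fract (|α|⁻¹ * m + c)
    have h4 : |α| * (|α|⁻¹ * m + c) = m + |α| * c := by field_simp
    have h5 : |α| * Int.fract (|α|⁻¹ * m + c) < 1 := by
      have := mul_lt_mul_of_pos_left h2 ha
      rwa [mul_inv_cancel₀ ha.ne'] at this
    have h6 := mul_pos ha h1
    rw [← h3, mul_add] at h4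
    constructor <;> linarith
  rcases lt_or_gt_of_ne hα with h | h
  · refine ⟨|α|⁻¹ * β, -1, Or.inr rfl, fun m h1 h2 => ?_⟩
    obtain ⟨h3, h4⟩ := key _ m h1 h2
    rw [mul_inv_cancel_left₀ ha.ne', abs_of_neg h] at h3 h4
    rw [abs_of_neg h, Int.floor_eq_iff]
    push_cast
    constructor <;> linarith
  · refine ⟨|α|⁻¹ * (1 - β), 1, Or.inl rfl, fun m h1 h2 => ?_⟩
    obtain ⟨h3, h4⟩ := key _ m h1 h2
    rw [mul_inv_cancel_left₀ ha.ne', abs_of_pos h] at h3 h4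
    rw [abs_of_pos h, Int.floor_eq_iff]
    push_cast
    constructor <;> linarith

/-- The bound for Beatty sequences of slope larger than one in absolute value, with an arbitrary
constant factor in the range of the index. -/
theorem eventually_exists_legendreSym_eq_neg_one (α β : ℝ) (hα : Irrational α) (hα1 : 1 < |α|)
    (ε : ℝ) (hε : 0 < ε) (hε1 : ε ≤ 1 / 10) (K : ℝ) (hK : 0 < K) :
    ∀ᶠ p : ℕ in atTop, ∀ hp : p.Prime, ∃ n : ℕ, 0 < n ∧
      K * n ≤ (p : ℝ) ^ (1 / (4 * √(Real.exp 1)) + ε) ∧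
        @legendreSym p ⟨hp⟩ ⌊α * n + β⌋ = -1 := by
  obtain ⟨c, σ, hσ, hfloor⟩ := exists_floor_eq_of_fract α β hα.ne_zero
  set γ := |α|⁻¹ with hγ
  have hγ0 : 0 < γ := inv_pos.mpr (by linarith)
  have hγ1 : γ < 1 := inv_lt_one_of_one_lt₀ hα1
  have hγirr : Irrational γ := by
    rcases abs_choice α with h | h
    · rw [hγ, h]; exact hα.inv
    · rw [hγ, h]; exact hα.neg.inv
  obtain ⟨m₀, hm₀⟩ := exists_nat_ge ((1 - c) / γ)
  set τ := 1 / (4 * √(Real.exp 1)) + ε with hτ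
  have hs1 := one_le_sqrt_exp_one
  have hτ0 : 0 < τ := by positivity
  have hτ1 : τ < 1 := by
    have : 1 / (4 * √(Real.exp 1)) ≤ 1 / 5 := by
      refine one_div_le_one_div_of_le (by norm_num) (by linarith)
    linarith
  set c₀ := 1 / (2 * K * γ) with hc₀
  have hc₀0 : 0 < c₀ := by positivity
  have hcast := tendsto_natCast_atTop_atTop (R := ℝ)
  have e1 := eventually_exists_qchar_ne γ c hγirr hγ0 hγ1 (m₀ + 1) ε hε hε1 c₀ hc₀0
  have e2 := hcast.eventually ((tendsto_rpow_atTop hτ0).eventually_ge_atTop (2 * K * |c|))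
  have e3 := hcast.eventually
    ((tendsto_rpow_atTop (show 0 < 1 - τ by linarith)).eventually_gt_atTop c₀)
  filter_upwards [e1, e2, e3] with p h1 h2 h3 hp
  have : Fact p.Prime := ⟨hp⟩
  have hP0 : (0 : ℝ) < p := by exact_mod_cast hp.pos
  have hσp : qchar p (σ : ZMod p) ^ 2 = 1 := by
    have hσ0 : (σ : ZMod p) ≠ 0 := by rcases hσ with rfl | rfl <;> simp
    rcases qchar_eq_one_or hσ0 with h | h <;> rw [h] <;> norm_num
  obtain ⟨m, hm1, hm2, hm3, hm4, hm5⟩ := h1 ⟨hp⟩ (qchar p (σ : ZMod p)) hσp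
  have hv1 : 1 ≤ γ * m + c := by
    rw [div_le_iff₀ hγ0] at hm₀
    have h4 : (m₀ : ℝ) ≤ m := by exact_mod_cast (by omega : m₀ ≤ m)
    nlinarith
  have hn1 : 1 ≤ ⌊γ * m + c⌋ := Int.le_floor.mpr (by exact_mod_cast hv1)
  obtain ⟨n, hn⟩ := Int.eq_ofNat_of_zero_le (by omega : 0 ≤ ⌊γ * m + c⌋)
  have hfl := hfloor m hm3 hm4
  rw [hn, Int.cast_natCast] at hfl
  refine ⟨n, by omega, ?_, ?_⟩
  · have h4 : (n : ℝ) ≤ γ * m + c := by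
      have := Int.floor_le (γ * m + c)
      rw [hn] at this
      exact_mod_cast this
    have h5 : K * (γ * m) ≤ (p : ℝ) ^ τ / 2 := by
      have h6 := mul_le_mul_of_nonneg_left hm2 (by positivity : 0 ≤ K * γ)
      have h7 : K * γ * (c₀ * (p : ℝ) ^ τ) = (p : ℝ) ^ τ / 2 := by rw [hc₀]; field_simp
      linarith
    have h6 : K * c ≤ (p : ℝ) ^ τ / 2 := by
      have := mul_le_mul_of_nonneg_left (le_abs_self c) hK.le
      linarith
    have h7 := mul_le_mul_of_nonneg_left h4 hK.le
    linarith
  · have hmp : m < p := by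
      have h4 : (m : ℝ) < p := by
        refine hm2.trans_lt ?_
        calc c₀ * (p : ℝ) ^ τ < (p : ℝ) ^ (1 - τ) * (p : ℝ) ^ τ := by gcongr
          _ = p := by rw [← Real.rpow_add hP0]; simp
      exact_mod_cast h4
    have hneg : qchar p ((σ * m : ℤ) : ZMod p) = -1 := by
      push_cast
      rw [qchar_mul]
      rcases eq_or_eq_neg_of_sq_eq_sq _ 1 (hσp.trans (one_pow 2).symm) with h | h
      all_goals
        rw [h] at hm5
        rcases qchar_natCast_eq_one_or (show 0 < m by omega) hmp with h4 | h4 <;>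
          simp_all
    rw [qchar] at hneg
    rw [hfl, legendreSym]
    exact_mod_cast hneg

end BeattyNonresidue

/-- For fixed real α (irrational) and β, and every ε > 0, for all sufficiently large
primes p there is a positive integer n ≤ p^{1/(4√e) + ε} with ⌊αn + β⌋ a quadratic
non-residue modulo p. -/
theorem least_nonresidue_beatty
    (α β : ℝ) (hα : Irrational α) (ε : ℝ) (hε : 0 < ε) :
    ∃ p₀ : ℕ, ∀ p : ℕ, p₀ ≤ p → ∀ hp : p.Prime,
      ∃ n : ℕ, 0 < n ∧ (n : ℝ) ≤ (p : ℝ) ^ (1 / (4 * Real.sqrt (Real.exp 1)) + ε) ∧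
        @legendreSym p ⟨hp⟩ ⌊α * n + β⌋ = -1 := by
  have hα0 : 0 < |α| := abs_pos.mpr hα.ne_zero
  obtain ⟨k, hk⟩ := exists_nat_gt (1 / |α|)
  have hk0 : (0 : ℝ) < k := lt_trans (by positivity) hk
  have hk0' : 0 < k := by exact_mod_cast hk0
  have hkα : 1 < |k * α| := by
    rw [abs_mul, Nat.abs_cast]
    rwa [div_lt_iff₀ hα0] at hk
  obtain ⟨p₀, hp₀⟩ := Filter.eventually_atTop.mp
    (BeattyNonresidue.eventually_exists_legendreSym_eq_neg_one (k * α) β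
      (hα.natCast_mul hk0'.ne') hkα (min ε (1 / 10)) (lt_min hε (by norm_num)) (min_le_right _ _)
      k hk0)
  refine ⟨p₀, fun p hp hpp => ?_⟩
  obtain ⟨n, hn0, hn, hleg⟩ := hp₀ p hp hpp
  refine ⟨k * n, Nat.mul_pos hk0' hn0, ?_, ?_⟩
  · push_cast
    refine hn.trans (Real.rpow_le_rpow_of_exponent_le (by exact_mod_cast hpp.one_lt.le) ?_)
    gcongr
    exact min_le_left _ _
  · rw [← hleg]
    congr 2
    push_cast
    ring
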